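/- Let C ⊆ S₁ be fork-convex, (process) solid and far-reaching, and let t₁ < t₂ in [0,T]. Then the set of multiplicative increments C_{t₂,t₁} = {Δ_{t₂,t₁}X : X ∈ C} ⊆ L⁰₊(F_{t₂}) is solid and convex, and its conditional polar with respect to F_{t₁}, taken among nonnegative F_{t₂}-measurable random variables, equals (C^×)_{t₂,t₁} = {Δ_{t₂,t₁}X : X ∈ C^×}. -/

import Mathlib

open MeasureTheory Filter Set
open scoped NNReal ENNReal

variable {Ω : Type*}

/-- A real function is càdlàg on `[0,T]`: right-continuous at every `t ∈ [0,T)` and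
with left limits at every `t ∈ (0,T]`. -/
def CadlagOn (T : ℝ) (f : ℝ → ℝ) : Prop :=
  (∀ t ∈ Set.Ico (0 : ℝ) T, Filter.Tendsto f (nhdsWithin t (Set.Ioi t)) (nhds (f t))) ∧
  (∀ t ∈ Set.Ioc (0 : ℝ) T, ∃ L : ℝ, Filter.Tendsto f (nhdsWithin t (Set.Iio t)) (nhds L))

/-- A positive process on `[0,T]`: adapted, nonnegative, with càdlàg paths. -/
def PosProc {m0 : MeasurableSpace Ω} (μ : Measure Ω) (T : ℝ)
    (ℱ : Filtration ℝ m0) (X : ℝ → Ω → ℝ) : Prop :=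
  (∀ t ∈ Set.Icc (0 : ℝ) T, StronglyMeasurable[ℱ t] (X t)) ∧
  (∀ᵐ ω ∂μ, ∀ t ∈ Set.Icc (0 : ℝ) T, 0 ≤ X t ω) ∧
  (∀ᵐ ω ∂μ, CadlagOn T (fun t => X t ω))

/-- A nonnegative càdlàg supermartingale on `[0,T]`. -/
def SuperMG {m0 : MeasurableSpace Ω} (μ : Measure Ω) (T : ℝ)
    (ℱ : Filtration ℝ m0) (X : ℝ → Ω → ℝ) : Prop :=
  PosProc μ T ℱ X ∧ (∀ t ∈ Set.Icc (0 : ℝ) T, Integrable (X t) μ) ∧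
  ∀ s t : ℝ, s ∈ Set.Icc (0 : ℝ) T → t ∈ Set.Icc (0 : ℝ) T → s ≤ t →
    μ[X t | ℱ s] ≤ᵐ[μ] X s

/-- Membership in `S₁`: a nonnegative càdlàg supermartingale with `Y₀ ≤ 1`. -/
def S1mem {m0 : MeasurableSpace Ω} (μ : Measure Ω) (T : ℝ)
    (ℱ : Filtration ℝ m0) (X : ℝ → Ω → ℝ) : Prop :=
  SuperMG μ T ℱ X ∧ ∀ᵐ ω ∂μ, X 0 ω ≤ 1

/-- Membership in `V`: a nonincreasing positive process with `B₀ ≤ 1`. -/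
def Vmem {m0 : MeasurableSpace Ω} (μ : Measure Ω) (T : ℝ)
    (ℱ : Filtration ℝ m0) (B : ℝ → Ω → ℝ) : Prop :=
  PosProc μ T ℱ B ∧
  (∀ᵐ ω ∂μ, ∀ s ∈ Set.Icc (0 : ℝ) T, ∀ t ∈ Set.Icc (0 : ℝ) T, s ≤ t → B t ω ≤ B s ω) ∧
  (∀ᵐ ω ∂μ, B 0 ω ≤ 1)

/-- The process polar `C^×`: all positive processes `Y` such that `XY` is a
supermartingale with `X₀Y₀ ≤ 1` for every `X ∈ C`. -/
def procPolar {m0 : MeasurableSpace Ω} (μ : Measure Ω) (T : ℝ)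
    (ℱ : Filtration ℝ m0) (C : Set (ℝ → Ω → ℝ)) : Set (ℝ → Ω → ℝ) :=
  {Y | PosProc μ T ℱ Y ∧ ∀ X ∈ C,
    SuperMG μ T ℱ (fun t ω => X t ω * Y t ω) ∧ ∀ᵐ ω ∂μ, X 0 ω * Y 0 ω ≤ 1}

/-- (Process) solidity: stability under multiplication by elements of `V`. -/
def ProcSolid {m0 : MeasurableSpace Ω} (μ : Measure Ω) (T : ℝ)
    (ℱ : Filtration ℝ m0) (C : Set (ℝ → Ω → ℝ)) : Prop :=
  ∀ Y ∈ C, ∀ B : ℝ → Ω → ℝ, Vmem μ T ℱ B → (fun t ω => Y t ω * B t ω) ∈ C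

/-- Fork-convexity (with the convention `0/0 = 0`, which holds for Lean division). -/
def ForkConvex {m0 : MeasurableSpace Ω} (μ : Measure Ω) (T : ℝ)
    (ℱ : Filtration ℝ m0) (C : Set (ℝ → Ω → ℝ)) : Prop :=
  ∀ s ∈ Set.Icc (0 : ℝ) T, ∀ h : Ω → ℝ, StronglyMeasurable[ℱ s] h →
    (∀ ω, 0 ≤ h ω) → (∀ ω, h ω ≤ 1) →
    ∀ Y1 ∈ C, ∀ Y2 ∈ C, ∀ Y3 ∈ C,
      (fun t ω => if t < s then Y1 t ω
        else Y1 s ω * (h ω * (Y2 t ω / Y2 s ω) + (1 - h ω) * (Y3 t ω / Y3 s ω))) ∈ C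

/-- Fatou convergence of a sequence of positive processes. -/
def FatouConv {m0 : MeasurableSpace Ω} (μ : Measure Ω) (T : ℝ) (Yn : ℕ → ℝ → Ω → ℝ) (Y : ℝ → Ω → ℝ) : Prop :=
  ∃ T' : Set ℝ, T'.Countable ∧ T' ⊆ Set.Icc 0 T ∧ Set.Icc (0 : ℝ) T ⊆ closure T' ∧
    ∀ᵐ ω ∂μ,
      (∀ t ∈ Set.Ico (0 : ℝ) T,
        (ENNReal.ofReal (Y t ω)
            = Filter.liminf
                (fun s => Filter.liminf (fun n => ENNReal.ofReal (Yn n s ω)) Filter.atTop)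
                (nhdsWithin t (Set.Ioi t ∩ T')) ∧
         ENNReal.ofReal (Y t ω)
            = Filter.limsup
                (fun s => Filter.limsup (fun n => ENNReal.ofReal (Yn n s ω)) Filter.atTop)
                (nhdsWithin t (Set.Ioi t ∩ T')))) ∧
      Filter.Tendsto (fun n => Yn n T ω) Filter.atTop (nhds (Y T ω))

/-- Closedness under Fatou convergence. -/
def FatouClosed {m0 : MeasurableSpace Ω} (μ : Measure Ω) (T : ℝ)
    (ℱ : Filtration ℝ m0) (C : Set (ℝ → Ω → ℝ)) : Prop :=
  ∀ (Yn : ℕ → ℝ → Ω → ℝ) (Y : ℝ → Ω → ℝ), (∀ n, Yn n ∈ C) → PosProc μ T ℱ Y →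
    FatouConv μ T Yn Y → Y ∈ C

/-- A set of processes is far-reaching if it has an element with `Y_T > 0` a.s. -/
def FarReaching {m0 : MeasurableSpace Ω} (μ : Measure Ω) (T : ℝ) (C : Set (ℝ → Ω → ℝ)) : Prop :=
  ∃ Y ∈ C, ∀ᵐ ω ∂μ, 0 < Y T ω

/-- The solid, fork-convex hull of `C`: the smallest (process) solid and fork-convex
subset of `S₁` containing `C`. -/
def solidForkHull {m0 : MeasurableSpace Ω} (μ : Measure Ω) (T : ℝ)
    (ℱ : Filtration ℝ m0) (C : Set (ℝ → Ω → ℝ)) : Set (ℝ → Ω → ℝ) :=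
  ⋂₀ {D | D ⊆ {X | S1mem μ T ℱ X} ∧ ProcSolid μ T ℱ D ∧ ForkConvex μ T ℱ D ∧ C ⊆ D}

/-- Extended (`[0,∞]`-valued) conditional expectation of a (nonnegative) function,
defined as the supremum of the conditional expectations of its truncations. -/
noncomputable def econd {mΩ : MeasurableSpace Ω} (μ : Measure Ω)
    (m : MeasurableSpace Ω) (f : Ω → ℝ) : Ω → ℝ≥0∞ :=
  fun ω => ⨆ n : ℕ, ENNReal.ofReal ((μ[fun ω' => min (f ω') n | m]) ω)

/-- The set of multiplicative increments `C_{t₂,t₁}` of a set of processes,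
as a set of (classes of) nonnegative `F_{t₂}`-measurable random variables. -/
def incrSet {m0 : MeasurableSpace Ω} (μ : Measure Ω) (ℱ : Filtration ℝ m0)
    (t₁ t₂ : ℝ) (C : Set (ℝ → Ω → ℝ)) : Set (Ω → ℝ) :=
  {f | StronglyMeasurable[ℱ t₂] f ∧ (∀ᵐ ω ∂μ, 0 ≤ f ω) ∧
    ∃ X ∈ C, f =ᵐ[μ] fun ω => X t₂ ω / X t₁ ω}

/-- The conditional polar with respect to `F_{t₁}`, taken among nonnegative
`F_{t₂}`-measurable random variables. -/
def condPolarAt {m0 : MeasurableSpace Ω} (μ : Measure Ω) (ℱ : Filtration ℝ m0)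
    (t₁ t₂ : ℝ) (D : Set (Ω → ℝ)) : Set (Ω → ℝ) :=
  {g | StronglyMeasurable[ℱ t₂] g ∧ (∀ᵐ ω ∂μ, 0 ≤ g ω) ∧
    ∀ f ∈ D, ∀ᵐ ω ∂μ, econd μ (ℱ t₁) (fun ω' => f ω' * g ω') ω ≤ 1}


/-- `CondLe μ m U V` expresses `E[U | m] ≤ E[V | m]` for `[0,∞]`-valued functions through
integrals over the sets of `m`. -/
def CondLe {m0 : MeasurableSpace Ω} (μ : Measure Ω) (m : MeasurableSpace Ω)
    (U V : Ω → ℝ≥0∞) : Prop :=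
  ∀ A, MeasurableSet[m] A → ∫⁻ ω in A, U ω ∂μ ≤ ∫⁻ ω in A, V ω ∂μ

namespace CondLe

variable {m m' m0 : MeasurableSpace Ω} {μ : Measure Ω}
  {U V W : Ω → ℝ≥0∞}

theorem of_ae_le (h : U ≤ᵐ[μ] V) : CondLe μ m U V := fun _ _ =>
  lintegral_mono_ae (ae_restrict_of_ae h)

theorem trans (h : CondLe μ m U V) (h' : CondLe μ m V W) : CondLe μ m U W :=
  fun A hA => (h A hA).trans (h' A hA)

theorem mono (hm : m ≤ m') (h : CondLe μ m' U V) : CondLe μ m U V :=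
  fun A hA => h A (hm A hA)

theorem congr {U' V' : Ω → ℝ≥0∞} (h : CondLe μ m U V) (hU : U =ᵐ[μ] U') (hV : V =ᵐ[μ] V') :
    CondLe μ m U' V' :=
  ((of_ae_le hU.symm.le).trans h).trans (of_ae_le hV.le)

theorem lintegral_le (h : CondLe μ m U V) : ∫⁻ ω, U ω ∂μ ≤ ∫⁻ ω, V ω ∂μ := by
  simpa using h univ (@MeasurableSet.univ _ m)

theorem lintegral_mul_le (hm : m ≤ m0) (hU : AEMeasurable U μ) (hV : AEMeasurable V μ)
    (h : CondLe μ m U V) {f : Ω → ℝ≥0∞} (hf : Measurable[m] f) :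
    ∫⁻ ω, f ω * U ω ∂μ ≤ ∫⁻ ω, f ω * V ω ∂μ := by
  have key : (μ.withDensity U).trim hm ≤ (μ.withDensity V).trim hm := by
    refine Measure.le_iff.2 fun A hA => ?_
    rw [trim_measurableSet_eq hm hA, trim_measurableSet_eq hm hA,
      withDensity_apply _ (hm A hA), withDensity_apply _ (hm A hA)]
    exact h A hA
  have e : ∀ G : Ω → ℝ≥0∞, AEMeasurable G μ →
      ∫⁻ ω, f ω * G ω ∂μ = ∫⁻ ω, f ω ∂((μ.withDensity G).trim hm) := by
    intro G hG
    rw [lintegral_trim hm hf, lintegral_withDensity_eq_lintegral_mul₀ hG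
      (hf.mono hm le_rfl).aemeasurable]
    simp [mul_comm]
  rw [e U hU, e V hV]
  exact lintegral_mono' key le_rfl

theorem mul_left (hm : m ≤ m0) (hU : AEMeasurable U μ) (hV : AEMeasurable V μ)
    (h : CondLe μ m U V) {f : Ω → ℝ≥0∞} (hf : Measurable[m] f) :
    CondLe μ m (fun ω => f ω * U ω) (fun ω => f ω * V ω) := by
  intro A hA
  have := lintegral_mul_le hm hU hV h (hf.indicator hA)
  rw [← lintegral_indicator (hm A hA), ← lintegral_indicator (hm A hA)]
  simpa only [Set.indicator_mul_left] using this

theorem add {U' V' : Ω → ℝ≥0∞} (hU : AEMeasurable U μ) (hV : AEMeasurable V μ)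
    (h : CondLe μ m U V) (h' : CondLe μ m U' V') :
    CondLe μ m (fun ω => U ω + U' ω) (fun ω => V ω + V' ω) := by
  intro A hA
  rw [lintegral_add_left' hU.restrict, lintegral_add_left' hV.restrict]
  exact add_le_add (h A hA) (h' A hA)

/-- Conditional Fatou lemma. -/
theorem of_tendsto {u : ℕ → Ω → ℝ≥0∞} (hu : ∀ n, AEMeasurable (u n) μ)
    (h : ∀ n, CondLe μ m (u n) V)
    (hlim : ∀ᵐ ω ∂μ, Tendsto (fun n => u n ω) atTop (nhds (U ω))) : CondLe μ m U V := by
  intro A hA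
  calc ∫⁻ ω in A, U ω ∂μ = ∫⁻ ω in A, liminf (fun n => u n ω) atTop ∂μ := by
        refine lintegral_congr_ae (ae_restrict_of_ae ?_)
        filter_upwards [hlim] with ω h using h.liminf_eq.symm
    _ ≤ liminf (fun n => ∫⁻ ω in A, u n ω ∂μ) atTop :=
        lintegral_liminf_le' fun n => (hu n).restrict
    _ ≤ ∫⁻ ω in A, V ω ∂μ := by
        refine liminf_le_of_le (by isBoundedDefault) fun b hb => ?_
        obtain ⟨n, hn⟩ := hb.exists
        exact hn.trans (h n A hA)

/-- A lower bound passes to the limit along a sequence of finer `σ`-algebras. -/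
theorem of_tendsto_right [IsFiniteMeasure μ] {mn : ℕ → MeasurableSpace Ω}
    (hmn : ∀ n, mn n ≤ m0) (hm : ∀ n, m ≤ mn n) {v : ℕ → Ω → ℝ≥0∞}
    (hv : ∀ n, Measurable[mn n] (v n)) (hU : AEMeasurable U μ)
    (h : ∀ n, CondLe μ (mn n) U (v n))
    (hlim : ∀ᵐ ω ∂μ, Tendsto (fun n => v n ω) atTop (nhds (V ω))) : CondLe μ m U V := by
  intro A hA
  have htr : ∀ c : ℕ, ∫⁻ ω in A, min (U ω) c ∂μ ≤ ∫⁻ ω in A, V ω ∂μ := by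
    intro c
    have h1 : ∀ n, ∫⁻ ω in A, min (U ω) c ∂μ ≤ ∫⁻ ω in A, min (v n ω) c ∂μ := by
      intro n
      have hs : MeasurableSet[mn n] {ω | v n ω ≤ c} := hv n measurableSet_Iic
      have hs0 := hmn n _ hs
      rw [← lintegral_inter_add_sdiff _ A hs0,
        ← lintegral_inter_add_sdiff (fun ω => min (v n ω) _) A hs0]
      refine add_le_add ?_ ?_
      · calc ∫⁻ ω in A ∩ {ω | v n ω ≤ c}, min (U ω) c ∂μ
            ≤ ∫⁻ ω in A ∩ {ω | v n ω ≤ c}, U ω ∂μ := lintegral_mono fun ω => min_le_left _ _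
          _ ≤ ∫⁻ ω in A ∩ {ω | v n ω ≤ c}, v n ω ∂μ := h n _ ((hm n A hA).inter hs)
          _ = _ := by
            refine setLIntegral_congr_fun ((hmn n _ (hm n A hA)).inter hs0) fun ω hω => ?_
            exact (min_eq_left hω.2).symm
      · refine setLIntegral_mono' ((hmn n _ (hm n A hA)).diff hs0) fun ω hω => ?_
        have : (c : ℝ≥0∞) ≤ v n ω := (not_le.1 hω.2).le
        simp [this]
    have h2 : Tendsto (fun n => ∫⁻ ω in A, min (v n ω) c ∂μ) atTop
        (nhds (∫⁻ ω in A, min (V ω) c ∂μ)) := by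
      refine tendsto_lintegral_of_dominated_convergence (fun _ => (c : ℝ≥0∞))
        (fun n => ((hv n).mono (hmn n) le_rfl).min measurable_const)
        (fun n => ae_of_all _ fun ω => min_le_right _ _) ?_ ?_
      · simp [ENNReal.mul_eq_top]
      · refine ae_restrict_of_ae ?_
        filter_upwards [hlim] with ω h using h.min tendsto_const_nhds
    exact (ge_of_tendsto' h2 h1).trans (lintegral_mono fun ω => min_le_left _ _)
  have h3 : Tendsto (fun c : ℕ => ∫⁻ ω in A, min (U ω) c ∂μ) atTop (nhds (∫⁻ ω in A, U ω ∂μ)) := by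
    refine lintegral_tendsto_of_tendsto_of_monotone
      (fun n => (hU.restrict.min aemeasurable_const)) ?_ ?_
    · exact ae_of_all _ fun ω i j hij => min_le_min le_rfl (by exact_mod_cast hij)
    · refine ae_of_all _ fun ω => ?_
      have : Tendsto (fun n : ℕ => min (U ω) n) atTop (nhds (min (U ω) ⊤)) :=
        tendsto_const_nhds.min ENNReal.tendsto_nat_nhds_top
      simpa using this
  exact le_of_tendsto' h3 htr

theorem ae_le [IsFiniteMeasure μ] (hm : m ≤ m0) (hU : Measurable[m] U) (hV : Measurable[m] V)
    (h : CondLe μ m U V) : U ≤ᵐ[μ] V := by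
  refine ae_le_of_ae_le_trim (hm := hm) ?_
  refine ae_le_of_forall_setLIntegral_le_of_sigmaFinite hU fun s hs _ => ?_
  rw [setLIntegral_trim hm hU hs, setLIntegral_trim hm hV hs]
  exact h s hs

theorem of_condExp_le [IsFiniteMeasure μ] (hm : m ≤ m0) {f g : Ω → ℝ} (hf : Integrable f μ)
    (hg : Integrable g μ) (hf0 : 0 ≤ᵐ[μ] f) (hg0 : 0 ≤ᵐ[μ] g) (h : μ[f | m] ≤ᵐ[μ] g) :
    CondLe μ m (fun ω => ENNReal.ofReal (f ω)) (fun ω => ENNReal.ofReal (g ω)) := by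
  intro A hA
  rw [← ofReal_integral_eq_lintegral_ofReal hf.integrableOn (ae_restrict_of_ae hf0),
    ← ofReal_integral_eq_lintegral_ofReal hg.integrableOn (ae_restrict_of_ae hg0)]
  refine ENNReal.ofReal_le_ofReal ?_
  rw [← setIntegral_condExp hm hf hA]
  exact setIntegral_mono_ae integrable_condExp.integrableOn hg.integrableOn h

theorem condExp_le [IsFiniteMeasure μ] (hm : m ≤ m0) {f g : Ω → ℝ} (hf : Integrable f μ)
    (hg : Integrable g μ) (hgm : StronglyMeasurable[m] g) (hf0 : 0 ≤ᵐ[μ] f) (hg0 : 0 ≤ᵐ[μ] g)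
    (h : CondLe μ m (fun ω => ENNReal.ofReal (f ω)) (fun ω => ENNReal.ofReal (g ω))) :
    μ[f | m] ≤ᵐ[μ] g := by
  refine ae_le_of_ae_le_trim (hm := hm) ?_
  refine ae_le_of_forall_setIntegral_le (integrable_condExp.trim hm stronglyMeasurable_condExp)
    (hg.trim hm hgm) fun s hs _ => ?_
  rw [← setIntegral_trim hm stronglyMeasurable_condExp hs, ← setIntegral_trim hm hgm hs,
    setIntegral_condExp hm hf hs,
    integral_eq_lintegral_of_nonneg_ae (ae_restrict_of_ae hf0) hf.1.restrict,
    integral_eq_lintegral_of_nonneg_ae (ae_restrict_of_ae hg0) hg.1.restrict]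
  refine ENNReal.toReal_mono ?_ (h s hs)
  exact (lt_of_le_of_lt (setLIntegral_le_lintegral _ _) hg.lintegral_lt_top).ne

end CondLe

/-- A family of `[0,∞]`-valued functions with bounded integrals that is stable under pasting along
the sets of `m` has an essential supremum of conditional expectations given `m`, which is
approximated along a sequence of members of the family. -/
theorem exists_esssup_condLExp {m m0 : MeasurableSpace Ω} {μ : Measure Ω}
    [IsFiniteMeasure μ] (hm : m ≤ m0) (H : Set (Ω → ℝ≥0∞)) (hne : H.Nonempty)
    (hbd : ∀ U ∈ H, ∫⁻ ω, U ω ∂μ ≤ 1)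
    (hpaste : ∀ U ∈ H, ∀ V ∈ H, ∀ A, MeasurableSet[m] A → ∃ K ∈ H,
      (∀ᵐ ω ∂μ, ω ∈ A → K ω = U ω) ∧ (∀ᵐ ω ∂μ, ω ∉ A → K ω = V ω)) :
    ∃ W : Ω → ℝ≥0∞, Measurable[m] W ∧ (∀ U ∈ H, CondLe μ m U W) ∧
      ∃ U : ℕ → Ω → ℝ≥0∞, (∀ n, U n ∈ H) ∧ ∃ k : ℕ → Ω → ℝ≥0∞, (∀ n, Measurable[m] (k n)) ∧
        (∀ n, CondLe μ m (k n) (U n)) ∧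
        ∀ᵐ ω ∂μ, Tendsto (fun n => k n ω) atTop (nhds (W ω)) := by
  classical
  set κ : (Ω → ℝ≥0∞) → Ω → ℝ≥0∞ := fun U => condLExp m μ U with hκ
  have κm : ∀ U, Measurable[m] (κ U) := fun U => measurable_condLExp _ _ _
  have κm0 : ∀ U, Measurable (κ U) := fun U => (κm U).mono hm le_rfl
  have κi : ∀ U A, MeasurableSet[m] A → ∫⁻ ω in A, κ U ω ∂μ = ∫⁻ ω in A, U ω ∂μ :=
    fun U A hA => setLIntegral_condLExp hm μ U hA
  have κI : ∀ U, ∫⁻ ω, κ U ω ∂μ = ∫⁻ ω, U ω ∂μ := fun U => lintegral_condLExp hm μ U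
  have hdir : ∀ U V : H, ∃ K : H, κ U ≤ᵐ[μ] κ K ∧ κ V ≤ᵐ[μ] κ K := by
    rintro ⟨U, hU⟩ ⟨V, hV⟩
    have hA : MeasurableSet[m] {ω | κ V ω ≤ κ U ω} := measurableSet_le (κm V) (κm U)
    obtain ⟨K, hK, h1, h2⟩ := hpaste U hU V hV _ hA
    have key : ∀ B, MeasurableSet[m] B → ∫⁻ ω in B, κ K ω ∂μ =
        ∫⁻ ω in B ∩ {ω | κ V ω ≤ κ U ω}, κ U ω ∂μ +
        ∫⁻ ω in B \ {ω | κ V ω ≤ κ U ω}, κ V ω ∂μ := by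
      intro B hB
      rw [κi K B hB, κi U _ (hB.inter hA), κi V _ (hB.diff hA),
        ← lintegral_inter_add_sdiff _ B (hm _ hA)]
      congr 1
      · refine setLIntegral_congr_fun_ae (hm _ (hB.inter hA)) ?_
        filter_upwards [h1] with ω h hω using h hω.2
      · refine setLIntegral_congr_fun_ae (hm _ (hB.diff hA)) ?_
        filter_upwards [h2] with ω h hω using h hω.2
    refine ⟨⟨K, hK⟩, CondLe.ae_le hm (κm _) (κm _) fun B hB => ?_,
      CondLe.ae_le hm (κm _) (κm _) fun B hB => ?_⟩
    · rw [key B hB, ← lintegral_inter_add_sdiff _ B (hm _ hA)]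
      refine add_le_add le_rfl (setLIntegral_mono' (hm _ (hB.diff hA)) fun ω hω => ?_)
      exact (not_le.1 hω.2).le
    · rw [key B hB, ← lintegral_inter_add_sdiff _ B (hm _ hA)]
      exact add_le_add (setLIntegral_mono' (hm _ (hB.inter hA)) fun ω hω => hω.2) le_rfl
  choose J hJ1 hJ2 using hdir
  set S : Set ℝ≥0∞ := (fun U => ∫⁻ ω, U ω ∂μ) '' H with hS
  have hM1 : sSup S ≤ 1 := sSup_le (by rintro _ ⟨U, hU, rfl⟩; exact hbd U hU)
  obtain ⟨s, -, hslim, hsmem⟩ := exists_seq_tendsto_sSup (hne.image _) (OrderTop.bddAbove S)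
  choose u huH hus using hsmem
  let K : ℕ → H := fun n => Nat.rec ⟨u 0, huH 0⟩ (fun n k => J k ⟨u (n + 1), huH (n + 1)⟩) n
  have hKmono : ∀ n, ∀ᵐ ω ∂μ, κ (K n).1 ω ≤ κ (K n.succ).1 ω := fun n => hJ1 (K n) _
  have hKu : ∀ n, κ (u n) ≤ᵐ[μ] κ (K n).1 := by
    intro n
    cases n with
    | zero => exact Filter.EventuallyLE.rfl
    | succ n => exact hJ2 (K n) ⟨u (n + 1), huH (n + 1)⟩
  have hleM : ∀ U : H, ∫⁻ ω, κ U ω ∂μ ≤ sSup S := fun U => by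
    rw [κI]; exact le_sSup ⟨U, U.2, rfl⟩
  let W : Ω → ℝ≥0∞ := fun ω => ⨆ n, κ (K n).1 ω
  have hWm : Measurable[m] W := Measurable.iSup fun n => κm _
  have hWI : sSup S ≤ ∫⁻ ω, W ω ∂μ := by
    refine le_of_tendsto' hslim fun n => ?_
    rw [← hus n]
    refine (κI (u n)).symm.le.trans ?_
    exact lintegral_mono_ae ((hKu n).trans (ae_of_all _ fun ω => le_iSup (fun n => κ (K n).1 ω) n))
  have hWI' : ∫⁻ ω, W ω ∂μ = ⨆ n, ∫⁻ ω, κ (K n).1 ω ∂μ :=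
    lintegral_iSup_ae (fun n => κm0 _) hKmono
  have hWtop : ∫⁻ ω, W ω ∂μ ≠ ∞ := by
    rw [hWI']
    exact (lt_of_le_of_lt ((iSup_le fun n => hleM _).trans hM1) ENNReal.one_lt_top).ne
  refine ⟨W, hWm, ?_, fun n => (K n).1, fun n => (K n).2, fun n => κ (K n).1, fun n => κm _, ?_, ?_⟩
  · intro V hV
    have h1 : ∫⁻ ω, max (W ω) (κ V ω) ∂μ ≤ ∫⁻ ω, W ω ∂μ := by
      calc ∫⁻ ω, max (W ω) (κ V ω) ∂μ = ∫⁻ ω, ⨆ n, max (κ (K n).1 ω) (κ V ω) ∂μ := by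
            refine lintegral_congr fun ω => ?_
            exact iSup_sup
        _ = ⨆ n, ∫⁻ ω, max (κ (K n).1 ω) (κ V ω) ∂μ := by
            refine lintegral_iSup_ae (fun n => (κm0 _).max (κm0 _)) fun n => ?_
            filter_upwards [hKmono n] with ω h using max_le_max h le_rfl
        _ ≤ sSup S := by
            refine iSup_le fun n => (lintegral_mono_ae ?_).trans (hleM (J (K n) ⟨V, hV⟩))
            filter_upwards [hJ1 (K n) ⟨V, hV⟩, hJ2 (K n) ⟨V, hV⟩] with ω h h' using max_le h h'
        _ ≤ _ := hWI
    have h2 := ae_eq_of_ae_le_of_lintegral_le (ae_of_all _ fun ω => le_max_left (W ω) (κ V ω))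
      hWtop ((hWm.mono hm le_rfl).max (κm0 _)).aemeasurable h1
    have h3 : κ V ≤ᵐ[μ] W := by
      filter_upwards [h2] with ω h
      rw [h]; exact le_max_right _ _
    intro A hA
    rw [← κi V A hA]
    exact CondLe.of_ae_le h3 A hA
  · intro n A hA
    exact (κi _ A hA).le
  · have := ae_all_iff.2 hKmono
    filter_upwards [this] with ω h
    exact tendsto_atTop_iSup (monotone_nat_of_le_succ h)

/-- `AltHit l u j S φ`: along increasing times in `S`, the function `φ` is alternately at most `l`
and at least `u`, in `j` turns the last of which is at least `u`. -/
def AltHit (l u : ℝ≥0∞) : ℕ → Set ℝ → (ℝ → ℝ≥0∞) → Prop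
  | 0, _, _ => True
  | j + 1, S, φ => ∃ s ∈ S, φ s ∈ (if Even j then Set.Ici u else Set.Iic l) ∧
      AltHit l u j (S ∩ Set.Ioi s) φ

namespace AltHit

variable {l u : ℝ≥0∞} {φ : ℝ → ℝ≥0∞}

theorem mono {j : ℕ} {S S' : Set ℝ} (hS : S ⊆ S') (h : AltHit l u j S φ) :
    AltHit l u j S' φ := by
  induction j generalizing S S' with
  | zero => trivial
  | succ j ih =>
    obtain ⟨s, hs, h1, h2⟩ := h
    exact ⟨s, hS hs, h1, ih (Set.inter_subset_inter_left _ hS) h2⟩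

theorem exists_finset {j : ℕ} {S : Set ℝ} (h : AltHit l u j S φ) :
    ∃ R : Finset ℝ, ↑R ⊆ S ∧ AltHit l u j R φ := by
  classical
  induction j generalizing S with
  | zero => exact ⟨∅, by simp, trivial⟩
  | succ j ih =>
    obtain ⟨s, hs, h1, h2⟩ := h
    obtain ⟨R, hR, h3⟩ := ih h2
    refine ⟨insert s R, ?_, s, by simp, h1, h3.mono fun x hx => ⟨by simp [hx], (hR hx).2⟩⟩
    simpa [Set.insert_subset_iff, hs] using hR.trans Set.inter_subset_left

theorem of_insert {j : ℕ} {s : ℝ} {S : Finset ℝ} (hs : ∀ x ∈ S, s < x)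
    (h : AltHit l u (j + 1) (insert s (S : Set ℝ)) φ) :
    (φ s ∈ (if Even j then Set.Ici u else Set.Iic l) ∧ AltHit l u j S φ) ∨
      AltHit l u (j + 1) S φ := by
  obtain ⟨x, hx, h1, h2⟩ := h
  rcases hx with rfl | hx
  · refine Or.inl ⟨h1, h2.mono ?_⟩
    rintro y ⟨rfl | hy, hy'⟩
    · exact (lt_irrefl _ (Set.mem_Ioi.1 hy')).elim
    · exact hy
  · refine Or.inr ⟨x, hx, h1, h2.mono ?_⟩
    rintro y ⟨rfl | hy, hy'⟩
    · exact absurd (hs x hx) (not_lt.2 (Set.mem_Ioi.1 hy').le)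
    · exact ⟨hy, hy'⟩

end AltHit

theorem measure_altHit_eq_iSup {m0 : MeasurableSpace Ω} {μ : Measure Ω} {v : ℝ → Ω → ℝ≥0∞}
    {l u : ℝ≥0∞} {D : Set ℝ} (hD : D.Countable) (j : ℕ) :
    μ {ω | AltHit l u j D (v · ω)} =
      ⨆ S : Finset D, μ {ω | AltHit l u j (S.map (Function.Embedding.subtype _)) (v · ω)} := by
  classical
  have := hD.to_subtype
  rw [← Directed.measure_iUnion]
  · congr 1
    ext ω
    simp only [Set.mem_ofPred_eq, Set.mem_iUnion]
    constructor
    · intro h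
      obtain ⟨R, hR, h⟩ := h.exists_finset
      refine ⟨R.subtype (· ∈ D), h.mono fun x hx => ?_⟩
      simpa using ⟨hx, hR hx⟩
    · rintro ⟨S, h⟩
      exact h.mono fun x hx => by simp at hx; exact hx.1
  · refine directed_of_isDirected_le fun S S' hS ω h => AltHit.mono ?_ h
    exact_mod_cast Finset.map_subset_map.2 hS

section Regularization

variable {m0 : MeasurableSpace Ω} {μ : Measure Ω}
  {ℱ : Filtration ℝ m0} {a b : ℝ} {v : ℝ → Ω → ℝ≥0∞} {l u : ℝ≥0∞}

theorem measure_altHit_succ_of_even (hv : ∀ t ∈ Set.Icc a b, Measurable[ℱ t] (v t))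
    (hsup : ∀ s ∈ Set.Icc a b, ∀ t ∈ Set.Icc a b, s ≤ t → CondLe μ (ℱ s) (v t) (v s))
    {j : ℕ} (hj : Even j) {p q : ℝ≥0∞}
    (h : ∀ S : Finset ℝ, ↑S ⊆ Set.Icc a b → ∀ r ∈ Set.Icc a b, (∀ s ∈ S, r ≤ s) →
      ∀ A, MeasurableSet[ℱ r] A → p * μ (A ∩ {ω | AltHit l u j S (v · ω)}) ≤ q * μ A)
    (S : Finset ℝ) (hS : ↑S ⊆ Set.Icc a b) (r : ℝ) (hr : r ∈ Set.Icc a b) (hrS : ∀ s ∈ S, r ≤ s)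
    (A : Set Ω) (hA : MeasurableSet[ℱ r] A) :
    p * u * μ (A ∩ {ω | AltHit l u (j + 1) S (v · ω)}) ≤ q * ∫⁻ ω in A, v r ω ∂μ := by
  classical
  induction S using Finset.induction_on_min generalizing r A with
  | empty => simp [AltHit]
  | insert s S hs ih =>
    have hsI : s ∈ Set.Icc a b := hS (by simp)
    have hSI : ↑S ⊆ Set.Icc a b := fun x hx => hS (by simp [Finset.mem_coe.1 hx])
    have hrs : r ≤ s := hrS s (by simp)
    have hA' : MeasurableSet[ℱ s] A := ℱ.mono hrs _ hA
    have hP : MeasurableSet[ℱ s] {ω | u ≤ v s ω} := hv s hsI measurableSet_Ici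
    have h1 := h S hSI s hsI (fun x hx => (hs x hx).le) _ (hA'.inter hP)
    have h2 := ih hSI s hsI (fun x hx => (hs x hx).le) _ (hA'.diff hP)
    have hsub : A ∩ {ω | AltHit l u (j + 1) ↑(insert s S) (v · ω)} ⊆
        ((A ∩ {ω | u ≤ v s ω}) ∩ {ω | AltHit l u j S (v · ω)}) ∪
        ((A \ {ω | u ≤ v s ω}) ∩ {ω | AltHit l u (j + 1) S (v · ω)}) ∪
        ((A ∩ {ω | u ≤ v s ω}) ∩ {ω | AltHit l u j S (v · ω)}) := by
      rintro ω ⟨hωA, hω⟩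
      rw [Set.mem_ofPred_eq, Finset.coe_insert] at hω
      by_cases hc : u ≤ v s ω
      · rcases AltHit.of_insert hs hω with hω | hω
        · exact Or.inr ⟨⟨hωA, hc⟩, hω.2⟩
        · obtain ⟨x, hx, -, h2⟩ := hω
          exact Or.inr ⟨⟨hωA, hc⟩, h2.mono Set.inter_subset_left⟩
      · rcases AltHit.of_insert hs hω with hω | hω
        · simp only [hj, if_true] at hω
          exact absurd hω.1 hc
        · exact Or.inl (Or.inr ⟨⟨hωA, hc⟩, hω⟩)
    rw [Set.union_right_comm, Set.union_self] at hsub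
    calc p * u * μ (A ∩ {ω | AltHit l u (j + 1) ↑(insert s S) (v · ω)})
        ≤ p * u * (μ ((A ∩ {ω | u ≤ v s ω}) ∩ {ω | AltHit l u j S (v · ω)}) +
          μ ((A \ {ω | u ≤ v s ω}) ∩ {ω | AltHit l u (j + 1) S (v · ω)})) :=
          mul_le_mul_right ((measure_mono hsub).trans (measure_union_le _ _)) _
      _ = u * (p * μ ((A ∩ {ω | u ≤ v s ω}) ∩ {ω | AltHit l u j S (v · ω)})) +
          p * u * μ ((A \ {ω | u ≤ v s ω}) ∩ {ω | AltHit l u (j + 1) S (v · ω)}) := by ring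
      _ ≤ u * (q * μ (A ∩ {ω | u ≤ v s ω})) + q * ∫⁻ ω in A \ {ω | u ≤ v s ω}, v s ω ∂μ := by
          gcongr
      _ = q * (∫⁻ ω in A ∩ {ω | u ≤ v s ω}, u ∂μ) + q * ∫⁻ ω in A \ {ω | u ≤ v s ω}, v s ω ∂μ := by
          rw [setLIntegral_const]; ring
      _ ≤ q * (∫⁻ ω in A ∩ {ω | u ≤ v s ω}, v s ω ∂μ) +
          q * ∫⁻ ω in A \ {ω | u ≤ v s ω}, v s ω ∂μ := by
          gcongr ?_ + _
          refine mul_le_mul_right (setLIntegral_mono' (ℱ.le s _ (hA'.inter hP)) fun ω hω => hω.2) _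
      _ = q * ∫⁻ ω in A, v s ω ∂μ := by
          rw [← mul_add, lintegral_inter_add_sdiff _ A (ℱ.le s _ hP)]
      _ ≤ q * ∫⁻ ω in A, v r ω ∂μ := mul_le_mul_right (hsup r hr s hsI hrs A hA) _

theorem measure_altHit_succ_of_odd (hv : ∀ t ∈ Set.Icc a b, Measurable[ℱ t] (v t))
    {j : ℕ} (hj : ¬ Even j) {p q : ℝ≥0∞}
    (h : ∀ S : Finset ℝ, ↑S ⊆ Set.Icc a b → ∀ r ∈ Set.Icc a b, (∀ s ∈ S, r ≤ s) →
      ∀ A, MeasurableSet[ℱ r] A →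
        p * μ (A ∩ {ω | AltHit l u j S (v · ω)}) ≤ q * ∫⁻ ω in A, v r ω ∂μ)
    (S : Finset ℝ) (hS : ↑S ⊆ Set.Icc a b) (r : ℝ) (hr : r ∈ Set.Icc a b) (hrS : ∀ s ∈ S, r ≤ s)
    (A : Set Ω) (hA : MeasurableSet[ℱ r] A) :
    p * μ (A ∩ {ω | AltHit l u (j + 1) S (v · ω)}) ≤ q * l * μ A := by
  classical
  induction S using Finset.induction_on_min generalizing r A with
  | empty => simp [AltHit]
  | insert s S hs ih =>
    have hsI : s ∈ Set.Icc a b := hS (by simp)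
    have hSI : ↑S ⊆ Set.Icc a b := fun x hx => hS (by simp [Finset.mem_coe.1 hx])
    have hrs : r ≤ s := hrS s (by simp)
    have hA' : MeasurableSet[ℱ s] A := ℱ.mono hrs _ hA
    have hP : MeasurableSet[ℱ s] {ω | v s ω ≤ l} := hv s hsI measurableSet_Iic
    have h1 := h S hSI s hsI (fun x hx => (hs x hx).le) _ (hA'.inter hP)
    have h2 := ih hSI s hsI (fun x hx => (hs x hx).le) _ (hA'.diff hP)
    have hsub : A ∩ {ω | AltHit l u (j + 1) ↑(insert s S) (v · ω)} ⊆
        ((A ∩ {ω | v s ω ≤ l}) ∩ {ω | AltHit l u j S (v · ω)}) ∪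
        ((A \ {ω | v s ω ≤ l}) ∩ {ω | AltHit l u (j + 1) S (v · ω)}) := by
      rintro ω ⟨hωA, hω⟩
      rw [Set.mem_ofPred_eq, Finset.coe_insert] at hω
      by_cases hc : v s ω ≤ l
      · rcases AltHit.of_insert hs hω with hω | hω
        · exact Or.inl ⟨⟨hωA, hc⟩, hω.2⟩
        · obtain ⟨x, hx, -, h2⟩ := hω
          exact Or.inl ⟨⟨hωA, hc⟩, h2.mono Set.inter_subset_left⟩
      · rcases AltHit.of_insert hs hω with hω | hω
        · simp only [hj, if_false] at hω
          exact absurd hω.1 hc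
        · exact Or.inr ⟨⟨hωA, hc⟩, hω⟩
    calc p * μ (A ∩ {ω | AltHit l u (j + 1) ↑(insert s S) (v · ω)})
        ≤ p * (μ ((A ∩ {ω | v s ω ≤ l}) ∩ {ω | AltHit l u j S (v · ω)}) +
          μ ((A \ {ω | v s ω ≤ l}) ∩ {ω | AltHit l u (j + 1) S (v · ω)})) :=
          mul_le_mul_right ((measure_mono hsub).trans (measure_union_le _ _)) _
      _ = p * μ ((A ∩ {ω | v s ω ≤ l}) ∩ {ω | AltHit l u j S (v · ω)}) +
          p * μ ((A \ {ω | v s ω ≤ l}) ∩ {ω | AltHit l u (j + 1) S (v · ω)}) := by ring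
      _ ≤ q * ∫⁻ ω in A ∩ {ω | v s ω ≤ l}, v s ω ∂μ + q * l * μ (A \ {ω | v s ω ≤ l}) := by
          gcongr
      _ ≤ q * ∫⁻ ω in A ∩ {ω | v s ω ≤ l}, l ∂μ + q * l * μ (A \ {ω | v s ω ≤ l}) := by
          gcongr ?_ + _
          refine mul_le_mul_right (setLIntegral_mono' (ℱ.le s _ (hA'.inter hP)) fun ω hω => hω.2) _
      _ = q * l * μ A := by
          rw [setLIntegral_const, ← mul_assoc, ← mul_add,
            measure_inter_add_sdiff A (ℱ.le s _ hP)]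

theorem measure_altHit_finset_le (hv : ∀ t ∈ Set.Icc a b, Measurable[ℱ t] (v t))
    (hsup : ∀ s ∈ Set.Icc a b, ∀ t ∈ Set.Icc a b, s ≤ t → CondLe μ (ℱ s) (v t) (v s)) (n : ℕ) :
    ∀ S : Finset ℝ, ↑S ⊆ Set.Icc a b → ∀ r ∈ Set.Icc a b, (∀ s ∈ S, r ≤ s) →
      ∀ A, MeasurableSet[ℱ r] A →
        u ^ n * μ (A ∩ {ω | AltHit l u (2 * n) S (v · ω)}) ≤ l ^ n * μ A := by
  induction n with
  | zero =>
    intro S _ r _ _ A _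
    simpa using measure_mono Set.inter_subset_left
  | succ n ih =>
    have h1 := measure_altHit_succ_of_even hv hsup (even_two_mul n) ih
    have h2 := measure_altHit_succ_of_odd (p := u ^ n * u) (q := l ^ n) hv
      (j := 2 * n + 1) (by simp) h1
    simpa only [pow_succ, mul_add, mul_one] using h2

theorem ae_exists_not_altHit [IsProbabilityMeasure μ] (hab : a ≤ b)
    (hv : ∀ t ∈ Set.Icc a b, Measurable[ℱ t] (v t))
    (hsup : ∀ s ∈ Set.Icc a b, ∀ t ∈ Set.Icc a b, s ≤ t → CondLe μ (ℱ s) (v t) (v s))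
    {D : Set ℝ} (hD : D.Countable) (hDI : D ⊆ Set.Icc a b) (hlu : l < u) (hu : u ≠ ∞) :
    ∀ᵐ ω ∂μ, ∃ n, ¬ AltHit l u (2 * n) D (v · ω) := by
  have hu0 : u ≠ 0 := (lt_of_le_of_lt bot_le hlu).ne'
  have hbound : ∀ n, μ {ω | AltHit l u (2 * n) D (v · ω)} ≤ (l / u) ^ n := by
    intro n
    rw [measure_altHit_eq_iSup hD]
    refine iSup_le fun S => ?_
    have := measure_altHit_finset_le (μ := μ) (l := l) (u := u) hv hsup n
      (S.map (Function.Embedding.subtype _))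
      (fun x hx => hDI (by simp at hx; exact hx.1)) a ⟨le_rfl, hab⟩
      (fun x hx => (hDI (by simp at hx; exact hx.1)).1) univ (@MeasurableSet.univ _ (ℱ a))
    rw [Set.univ_inter, measure_univ, mul_one] at this
    rw [ENNReal.div_eq_inv_mul, mul_pow, ← ENNReal.inv_pow]
    rw [← ENNReal.div_eq_inv_mul]
    rw [ENNReal.le_div_iff_mul_le (Or.inl (pow_ne_zero _ hu0))
      (Or.inl (ENNReal.pow_ne_top hu)), mul_comm]
    exact this
  rw [ae_iff]
  refine le_antisymm ?_ bot_le
  have hlim : Tendsto (fun n : ℕ => (l / u) ^ n) atTop (nhds 0) :=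
    ENNReal.tendsto_pow_atTop_nhds_zero_of_lt_one
      ((ENNReal.div_lt_iff (Or.inl hu0) (Or.inl hu)).2 (by simpa using hlu))
  refine ge_of_tendsto' hlim fun n => (measure_mono fun ω hω => ?_).trans (hbound n)
  simp only [not_exists, not_not, Set.mem_ofPred_eq] at hω
  exact hω n

theorem ae_bddAbove_of_condLe (hab : a ≤ b) (hv : ∀ t ∈ Set.Icc a b, Measurable[ℱ t] (v t))
    (hsup : ∀ s ∈ Set.Icc a b, ∀ t ∈ Set.Icc a b, s ≤ t → CondLe μ (ℱ s) (v t) (v s))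
    (hfin : ∫⁻ ω, v a ω ∂μ ≠ ∞)
    {D : Set ℝ} (hD : D.Countable) (hDI : D ⊆ Set.Icc a b) :
    ∀ᵐ ω ∂μ, ∃ n : ℕ, ∀ s ∈ D, v s ω ≤ n := by
  have hbound : ∀ n : ℕ, (n : ℝ≥0∞) * μ {ω | AltHit 0 n 1 D (v · ω)} ≤ ∫⁻ ω, v a ω ∂μ := by
    intro n
    rw [measure_altHit_eq_iSup hD, ENNReal.mul_iSup]
    refine iSup_le fun S => ?_
    have := measure_altHit_succ_of_even (μ := μ) (l := 0) (u := n) hv hsup (j := 0) (by simp)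
      (p := 1) (q := 1) (by
        intro S _ r _ _ A _
        simpa using measure_mono Set.inter_subset_left)
      (S.map (Function.Embedding.subtype _))
      (fun x hx => hDI (by simp at hx; exact hx.1)) a ⟨le_rfl, hab⟩
      (fun x hx => (hDI (by simp at hx; exact hx.1)).1) univ (@MeasurableSet.univ _ (ℱ a))
    simpa using this
  have hbound' : ∀ n : ℕ, μ {ω | ∀ n : ℕ, ∃ s ∈ D, n < v s ω} ≤ (∫⁻ ω, v a ω ∂μ) / (n + 1 : ℕ) := by
    intro n
    rw [ENNReal.le_div_iff_mul_le (Or.inl (by simp)) (Or.inl (by simp)), mul_comm]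
    refine (mul_le_mul_right (measure_mono fun ω hω => ?_) _).trans (hbound (n + 1))
    obtain ⟨s, hs, h⟩ := hω (n + 1)
    exact ⟨s, hs, by simpa using h.le, trivial⟩
  rw [ae_iff]
  refine le_antisymm ?_ bot_le
  have hlim : Tendsto (fun n : ℕ => (∫⁻ ω, v a ω ∂μ) / (n + 1 : ℕ)) atTop (nhds 0) :=
    (ENNReal.Tendsto.const_div (ENNReal.tendsto_nat_nhds_top.comp (tendsto_add_atTop_nat 1))
      (Or.inr hfin)).trans (by simp)
  refine ge_of_tendsto' hlim fun n => (measure_mono fun ω hω => ?_).trans (hbound' n)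
  simpa using hω

theorem setLIntegral_le_of_exists_lt (hv : ∀ t ∈ Set.Icc a b, Measurable[ℱ t] (v t))
    (hsup : ∀ s ∈ Set.Icc a b, ∀ t ∈ Set.Icc a b, s ≤ t → CondLe μ (ℱ s) (v t) (v s))
    (hab : a ≤ b) {ε : ℝ≥0∞} (S : Finset ℝ) (hS : ↑S ⊆ Set.Icc a b)
    (r : ℝ) (hrS : ∀ s ∈ S, r ≤ s)
    (A : Set Ω) (hA : MeasurableSet[ℱ r] A) :
    ∫⁻ ω in A ∩ {ω | ∃ s ∈ S, v s ω ≤ ε}, v b ω ∂μ ≤ ε * μ A := by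
  classical
  induction S using Finset.induction_on_min generalizing r A with
  | empty => simp
  | insert s S hs ih =>
    have hsI : s ∈ Set.Icc a b := hS (by simp)
    have hSI : ↑S ⊆ Set.Icc a b := fun x hx => hS (by simp [Finset.mem_coe.1 hx])
    have hrs : r ≤ s := hrS s (by simp)
    have hA' : MeasurableSet[ℱ s] A := ℱ.mono hrs _ hA
    have hP : MeasurableSet[ℱ s] {ω | v s ω ≤ ε} := hv s hsI measurableSet_Iic
    have h2 := ih hSI s (fun x hx => (hs x hx).le) _ (hA'.diff hP)
    have hsub : A ∩ {ω | ∃ x ∈ insert s S, v x ω ≤ ε} ⊆ (A ∩ {ω | v s ω ≤ ε}) ∪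
        ((A \ {ω | v s ω ≤ ε}) ∩ {ω | ∃ x ∈ S, v x ω ≤ ε}) := by
      rintro ω ⟨hωA, x, hx, hω⟩
      by_cases hc : v s ω ≤ ε
      · exact Or.inl ⟨hωA, hc⟩
      · rcases Finset.mem_insert.1 hx with rfl | hx
        · exact absurd hω hc
        · exact Or.inr ⟨⟨hωA, hc⟩, x, hx, hω⟩
    calc _ ≤ ∫⁻ ω in (A ∩ {ω | v s ω ≤ ε}) ∪
          ((A \ {ω | v s ω ≤ ε}) ∩ {ω | ∃ x ∈ S, v x ω ≤ ε}), v b ω ∂μ := lintegral_mono_set hsub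
      _ ≤ ∫⁻ ω in A ∩ {ω | v s ω ≤ ε}, v b ω ∂μ +
          ∫⁻ ω in (A \ {ω | v s ω ≤ ε}) ∩ {ω | ∃ x ∈ S, v x ω ≤ ε}, v b ω ∂μ :=
          lintegral_union_le _ _ _
      _ ≤ ∫⁻ ω in A ∩ {ω | v s ω ≤ ε}, ε ∂μ + ε * μ (A \ {ω | v s ω ≤ ε}) := by
          refine add_le_add ?_ h2
          exact (hsup s hsI b ⟨hab, le_rfl⟩ hsI.2 _ (hA'.inter hP)).trans
            (setLIntegral_mono' (ℱ.le s _ (hA'.inter hP)) fun ω hω => hω.2)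
      _ = ε * μ A := by
          rw [setLIntegral_const, ← mul_add, measure_inter_add_sdiff A (ℱ.le s _ hP)]

theorem ae_pos_of_condLe [IsProbabilityMeasure μ] (hab : a ≤ b)
    (hv : ∀ t ∈ Set.Icc a b, Measurable[ℱ t] (v t))
    (hsup : ∀ s ∈ Set.Icc a b, ∀ t ∈ Set.Icc a b, s ≤ t → CondLe μ (ℱ s) (v t) (v s))
    (hpos : ∀ᵐ ω ∂μ, 0 < v b ω)
    {D : Set ℝ} (hD : D.Countable) (hDI : D ⊆ Set.Icc a b) :
    ∀ᵐ ω ∂μ, ∃ n : ℕ, ∀ s ∈ D, ((n + 1 : ℕ) : ℝ≥0∞)⁻¹ ≤ v s ω := by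
  classical
  have := hD.to_subtype
  set G : Set Ω := {ω | ∀ n : ℕ, ∃ s ∈ D, v s ω < ((n + 1 : ℕ) : ℝ≥0∞)⁻¹} with hG
  have hvm : ∀ s ∈ D, Measurable (v s) := fun s hs => (hv s (hDI hs)).mono (ℱ.le s) le_rfl
  have hbound : ∀ n : ℕ, ∫⁻ ω in G, v b ω ∂μ ≤ ((n + 1 : ℕ) : ℝ≥0∞)⁻¹ := by
    intro n
    set ε := ((n + 1 : ℕ) : ℝ≥0∞)⁻¹
    have hsub : G ⊆ ⋃ S : Finset D, {ω | ∃ s ∈ S.map (Function.Embedding.subtype _),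
        v s ω ≤ ε} := by
      intro ω hω
      obtain ⟨s, hs, h⟩ := hω n
      exact Set.mem_iUnion.2 ⟨{⟨s, hs⟩}, s, by simp, h.le⟩
    refine (lintegral_mono_set hsub).trans ?_
    have hmeas : ∀ S : Finset D, MeasurableSet
        {ω | ∃ s ∈ S.map (Function.Embedding.subtype _), v s ω ≤ ε} := by
      intro S
      have : {ω | ∃ s ∈ S.map (Function.Embedding.subtype _), v s ω ≤ ε} =
          ⋃ s ∈ S, {ω | v s ω ≤ ε} := by
        ext ω; simp
      rw [this]
      exact Finset.measurableSet_biUnion _ fun s _ => hvm s s.2 measurableSet_Iic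
    rw [← withDensity_apply _ (MeasurableSet.iUnion hmeas), Directed.measure_iUnion]
    · refine iSup_le fun S => ?_
      rw [withDensity_apply _ (hmeas S)]
      have := setLIntegral_le_of_exists_lt (μ := μ) (ε := ε) hv hsup hab
        (S.map (Function.Embedding.subtype _))
        (fun x hx => hDI (by simp at hx; exact hx.1)) a
        (fun x hx => (hDI (by simp at hx; exact hx.1)).1) univ (@MeasurableSet.univ _ (ℱ a))
      simpa using this
    · refine directed_of_isDirected_le fun S S' hS ω h => ?_
      obtain ⟨s, hs, h⟩ := h
      exact ⟨s, Finset.map_subset_map.2 hS hs, h⟩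
  have hzero : ∫⁻ ω in G, v b ω ∂μ = 0 := by
    have hlim : Tendsto (fun n : ℕ => ((n + 1 : ℕ) : ℝ≥0∞)⁻¹) atTop (nhds 0) :=
      ENNReal.tendsto_inv_nat_nhds_zero.comp (tendsto_add_atTop_nat 1)
    exact le_antisymm (ge_of_tendsto' hlim hbound) bot_le
  have hGm : MeasurableSet G := by
    have : G = ⋂ n : ℕ, ⋃ s : D, {ω | v s ω < ((n + 1 : ℕ) : ℝ≥0∞)⁻¹} := by
      ext ω; simp [hG]
    rw [this]
    exact MeasurableSet.iInter fun n => MeasurableSet.iUnion fun s =>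
      hvm s s.2 measurableSet_Iio
  have hvb : Measurable (v b) := (hv b ⟨hab, le_rfl⟩).mono (ℱ.le b) le_rfl
  rw [setLIntegral_eq_zero_iff hGm hvb] at hzero
  filter_upwards [hzero, hpos] with ω h1 h2
  by_contra! hc
  exact h2.ne' (h1 hc)

end Regularization

section Paths

variable {D : Set ℝ} {a b t : ℝ}

theorem eventually_nhdsWithin_Ioi_inter {P : ℝ → Prop} :
    (∀ᶠ y in nhdsWithin t (Set.Ioi t ∩ D), P y) ↔ ∃ c > t, ∀ y ∈ Set.Ioo t c, y ∈ D → P y := by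
  rw [nhdsWithin_inter', eventually_inf_principal,
    (nhdsGT_basis t).eventually_iff]

theorem eventually_nhdsWithin_Iio_inter {P : ℝ → Prop} :
    (∀ᶠ y in nhdsWithin t (Set.Iio t ∩ D), P y) ↔ ∃ c < t, ∀ y ∈ Set.Ioo c t, y ∈ D → P y := by
  rw [nhdsWithin_inter', eventually_inf_principal,
    (nhdsLT_basis t).eventually_iff]

theorem exists_tendsto_nhdsWithin_Ioi_inter {φ : ℝ → ℝ≥0∞} {Q : Set ℝ≥0∞} (hQ : Dense Q)
    (h : ∀ l ∈ Q, ∀ u ∈ Q, l < u → ∃ n, ¬ AltHit l u (2 * n) D φ) :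
    ∃ L, Tendsto φ (nhdsWithin t (Set.Ioi t ∩ D)) (nhds L) := by
  refine tendsto_of_no_upcrossings hQ fun l hl u hu hlu ⟨h1, h2⟩ => ?_
  obtain ⟨n, hn⟩ := h l hl u hu hlu
  have key : ∀ j, AltHit l u j (D ∩ Set.Ioi t) φ := by
    intro j
    induction j with
    | zero => trivial
    | succ j ih =>
      obtain ⟨R, hR, h3⟩ := ih.exists_finset
      obtain ⟨c, hc, hcR⟩ : ∃ c > t, ∀ x ∈ R, c ≤ x := by
        rcases R.eq_empty_or_nonempty with rfl | hne
        · exact ⟨t + 1, by simp, by simp⟩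
        · exact ⟨R.min' hne, (hR (R.min'_mem hne)).2, fun x hx => R.min'_le x hx⟩
      have key : ∃ s ∈ D, s ∈ Set.Ioo t c ∧ φ s ∈ (if Even j then Set.Ici u else Set.Iic l) := by
        by_contra! hcon
        have hev : ∀ᶠ y in nhdsWithin t (Set.Ioi t ∩ D),
            φ y ∉ (if Even j then Set.Ici u else Set.Iic l) :=
          eventually_nhdsWithin_Ioi_inter.2 ⟨c, hc, fun y hy hyD => hcon y hyD hy⟩
        split_ifs at hev with hj
        · exact h2 (hev.mono fun y hy hy' => hy (Set.mem_Ici.2 hy'.le))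
        · exact h1 (hev.mono fun y hy hy' => hy (Set.mem_Iic.2 hy'.le))
      obtain ⟨s, hsD, hs, hφ⟩ := key
      exact ⟨s, ⟨hsD, hs.1⟩, hφ, h3.mono fun x hx => ⟨hR hx, hs.2.trans_le (hcR x hx)⟩⟩
  exact hn ((key _).mono Set.inter_subset_left)

theorem exists_tendsto_nhdsWithin_Iio_inter {φ : ℝ → ℝ≥0∞} {Q : Set ℝ≥0∞} (hQ : Dense Q)
    (h : ∀ l ∈ Q, ∀ u ∈ Q, l < u → ∃ n, ¬ AltHit l u (2 * n) D φ) :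
    ∃ L, Tendsto φ (nhdsWithin t (Set.Iio t ∩ D)) (nhds L) := by
  refine tendsto_of_no_upcrossings hQ fun l hl u hu hlu ⟨h1, h2⟩ => ?_
  obtain ⟨n, hn⟩ := h l hl u hu hlu
  have key : ∀ j, ∀ c < t, AltHit l u j (D ∩ Set.Ioo c t) φ := by
    intro j
    induction j with
    | zero => exact fun _ _ => trivial
    | succ j ih =>
      intro c hc
      have key : ∃ s ∈ D, s ∈ Set.Ioo c t ∧ φ s ∈ (if Even j then Set.Ici u else Set.Iic l) := by
        by_contra! hcon
        have hev : ∀ᶠ y in nhdsWithin t (Set.Iio t ∩ D),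
            φ y ∉ (if Even j then Set.Ici u else Set.Iic l) :=
          eventually_nhdsWithin_Iio_inter.2 ⟨c, hc, fun y hy hyD => hcon y hyD hy⟩
        split_ifs at hev with hj
        · exact h2 (hev.mono fun y hy hy' => hy (Set.mem_Ici.2 hy'.le))
        · exact h1 (hev.mono fun y hy hy' => hy (Set.mem_Iic.2 hy'.le))
      obtain ⟨s, hsD, hs, hφ⟩ := key
      exact ⟨s, ⟨hsD, hs⟩, hφ, (ih s hs.2).mono
        fun x hx => ⟨⟨hx.1, hs.1.trans hx.2.1, hx.2.2⟩, hx.2.1⟩⟩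
  exact hn ((key _ (t - 1) (by linarith)).mono Set.inter_subset_left)

theorem neBot_nhdsWithin_Ioi_inter (hD : ∀ x y, x < y → x ∈ Set.Ico a b → ∃ q ∈ D, q ∈ Set.Ioo x y)
    (ht : t ∈ Set.Ico a b) : (nhdsWithin t (Set.Ioi t ∩ D)).NeBot := by
  refine ⟨fun hbot => ?_⟩
  have : ∀ᶠ y in nhdsWithin t (Set.Ioi t ∩ D), False := by rw [hbot]; simp
  obtain ⟨c, hc, h⟩ := eventually_nhdsWithin_Ioi_inter.1 this
  obtain ⟨q, hqD, hq⟩ := hD t c hc ht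
  exact h q hq hqD

theorem tendsto_nhdsGT_of_tendsto_inter {E : Type*} [TopologicalSpace E] [RegularSpace E]
    (hD : ∀ x y, x < y → x ∈ Set.Ico a b → ∃ q ∈ D, q ∈ Set.Ioo x y)
    {φ ψ : ℝ → E} {L : E} (ht : t ∈ Set.Ico a b)
    (hL : Tendsto φ (nhdsWithin t (Set.Ioi t ∩ D)) (nhds L))
    (hψ : ∀ s ∈ Set.Ico a b, Tendsto φ (nhdsWithin s (Set.Ioi s ∩ D)) (nhds (ψ s))) :
    Tendsto ψ (nhdsWithin t (Set.Ioi t)) (nhds L) := by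
  refine (closed_nhds_basis L).tendsto_right_iff.2 fun V hV => ?_
  obtain ⟨c, hc, h⟩ := eventually_nhdsWithin_Ioi_inter.1 (hL hV.1)
  filter_upwards [Ioo_mem_nhdsGT (lt_min hc ht.2)] with s hs
  have hs' : s ∈ Set.Ico a b := ⟨ht.1.trans hs.1.le, hs.2.trans_le (min_le_right _ _)⟩
  have := neBot_nhdsWithin_Ioi_inter hD hs'
  exact hV.2.mem_of_tendsto (hψ s hs') (eventually_nhdsWithin_Ioi_inter.2
    ⟨c, hs.2.trans_le (min_le_left _ _), fun y hy => h y ⟨hs.1.trans hy.1, hy.2⟩⟩)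

theorem tendsto_nhdsLT_of_tendsto_inter {E : Type*} [TopologicalSpace E] [RegularSpace E]
    (hD : ∀ x y, x < y → x ∈ Set.Ico a b → ∃ q ∈ D, q ∈ Set.Ioo x y)
    {φ ψ : ℝ → E} {L : E} (ht : t ∈ Set.Ioc a b)
    (hL : Tendsto φ (nhdsWithin t (Set.Iio t ∩ D)) (nhds L))
    (hψ : ∀ s ∈ Set.Ico a b, Tendsto φ (nhdsWithin s (Set.Ioi s ∩ D)) (nhds (ψ s))) :
    Tendsto ψ (nhdsWithin t (Set.Iio t)) (nhds L) := by
  refine (closed_nhds_basis L).tendsto_right_iff.2 fun V hV => ?_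
  obtain ⟨c, hc, h⟩ := eventually_nhdsWithin_Iio_inter.1 (hL hV.1)
  filter_upwards [Ioo_mem_nhdsLT (max_lt hc ht.1)] with s hs
  have hs' : s ∈ Set.Ico a b := ⟨((le_max_right _ _).trans_lt hs.1).le, hs.2.trans_le ht.2⟩
  have := neBot_nhdsWithin_Ioi_inter hD hs'
  exact hV.2.mem_of_tendsto (hψ s hs') (eventually_nhdsWithin_Ioi_inter.2
    ⟨t, hs.2, fun y hy => h y ⟨((le_max_left _ _).trans_lt hs.1).trans hy.1, hy.2⟩⟩)

theorem cadlagOn_ite {T s : ℝ} {f g : ℝ → ℝ}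
    (hf : ∀ t ∈ Set.Ico 0 T, t < s → Tendsto f (nhdsWithin t (Set.Ioi t)) (nhds (f t)))
    (hf' : ∀ t ∈ Set.Ioc 0 T, t ≤ s → ∃ L, Tendsto f (nhdsWithin t (Set.Iio t)) (nhds L))
    (hg : ∀ t ∈ Set.Ico 0 T, s ≤ t → Tendsto g (nhdsWithin t (Set.Ioi t)) (nhds (g t)))
    (hg' : ∀ t ∈ Set.Ioc 0 T, s < t → ∃ L, Tendsto g (nhdsWithin t (Set.Iio t)) (nhds L)) :
    CadlagOn T (fun t => if t < s then f t else g t) := by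
  refine ⟨fun t ht => ?_, fun t ht => ?_⟩
  · rcases lt_or_ge t s with h | h
    · show Tendsto _ _ (nhds (if t < s then f t else g t))
      rw [if_pos h]
      refine (hf t ht h).congr' ?_
      filter_upwards [Ioo_mem_nhdsGT h] with x hx
      rw [if_pos hx.2]
    · show Tendsto _ _ (nhds (if t < s then f t else g t))
      rw [if_neg h.not_gt]
      refine (hg t ht h).congr' ?_
      filter_upwards [self_mem_nhdsWithin] with x hx
      rw [if_neg (h.trans (le_of_lt hx)).not_gt]
  · rcases le_or_gt t s with h | h
    · obtain ⟨L, hL⟩ := hf' t ht h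
      refine ⟨L, hL.congr' ?_⟩
      filter_upwards [self_mem_nhdsWithin] with x hx
      rw [if_pos (lt_of_lt_of_le hx h)]
    · obtain ⟨L, hL⟩ := hg' t ht h
      refine ⟨L, hL.congr' ?_⟩
      filter_upwards [Ioo_mem_nhdsLT h] with x hx
      rw [if_neg hx.1.not_gt]

theorem CadlagOn.mul {T : ℝ} {f g : ℝ → ℝ} (hf : CadlagOn T f) (hg : CadlagOn T g) :
    CadlagOn T (fun t => f t * g t) := by
  refine ⟨fun t ht => (hf.1 t ht).mul (hg.1 t ht), fun t ht => ?_⟩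
  obtain ⟨L, hL⟩ := hf.2 t ht
  obtain ⟨M, hM⟩ := hg.2 t ht
  exact ⟨_, hL.mul hM⟩

end Paths

section RightLimit

variable {m0 : MeasurableSpace Ω} {μ : Measure Ω} [IsProbabilityMeasure μ]
  {ℱ : Filtration ℝ m0} {a b : ℝ}

theorem exists_rat_mem_Ioo_inter {x y : ℝ} (hxy : x < y) (hx : x ∈ Set.Ico a b) :
    ∃ q ∈ Set.Ioo a b ∩ Set.range ((↑) : ℚ → ℝ), q ∈ Set.Ioo x y := by
  obtain ⟨q, h1, h2⟩ := exists_rat_btwn (lt_min hxy hx.2)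
  exact ⟨q, ⟨⟨hx.1.trans_lt h1, h2.trans_le (min_le_right _ _)⟩, q, rfl⟩, h1,
    h2.trans_le (min_le_left _ _)⟩

/-- A `[0,∞]`-valued supermartingale has a regularization by right limits along the rationals. -/
theorem exists_rightLimit_of_condLe
    (hrc : ∀ t : ℝ, (ℱ t : MeasurableSpace Ω) = ⨅ (s : ℝ) (_ : t < s), ℱ s)
    (hab : a < b) {v : ℝ → Ω → ℝ≥0∞} (hv : ∀ t ∈ Set.Icc a b, Measurable[ℱ t] (v t))
    (hsup : ∀ s ∈ Set.Icc a b, ∀ t ∈ Set.Icc a b, s ≤ t → CondLe μ (ℱ s) (v t) (v s))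
    (hfin : ∫⁻ ω, v a ω ∂μ ≠ ∞) :
    ∃ Z : ℝ → Ω → ℝ, (∀ t ∈ Set.Ico a b, Measurable[ℱ t] (Z t)) ∧ (∀ t ω, 0 ≤ Z t ω) ∧
      (∀ t ∈ Set.Ico a b, ∃ q : ℕ → ℝ, (∀ n, q n ∈ Set.Ioo t b) ∧ Tendsto q atTop (nhds t) ∧
        ∀ᵐ ω ∂μ, Tendsto (fun n => v (q n) ω) atTop (nhds (ENNReal.ofReal (Z t ω)))) ∧
      ∀ᵐ ω ∂μ, (∀ t ∈ Set.Ico a b,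
          Tendsto (Z · ω) (nhdsWithin t (Set.Ioi t)) (nhds (Z t ω))) ∧
        ∀ t ∈ Set.Ioc a b, ∃ L, Tendsto (Z · ω) (nhdsWithin t (Set.Iio t)) (nhds L) := by
  classical
  set D : Set ℝ := Set.Ioo a b ∩ Set.range ((↑) : ℚ → ℝ) with hD
  have hDc : D.Countable := (Set.countable_range _).mono Set.inter_subset_right
  have hDI : D ⊆ Set.Icc a b := fun x hx => ⟨hx.1.1.le, hx.1.2.le⟩
  have hDd : ∀ x y, x < y → x ∈ Set.Ico a b → ∃ q ∈ D, q ∈ Set.Ioo x y :=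
    fun x y => exists_rat_mem_Ioo_inter
  have hq : ∀ t, ∃ q : ℕ → ℝ, t ∈ Set.Ico a b → StrictAnti q ∧ (∀ n, q n ∈ Set.Ioo t b) ∧
      (∀ n, q n ∈ D) ∧ Tendsto q atTop (nhds t) := by
    intro t
    by_cases ht : t ∈ Set.Ico a b
    · obtain ⟨q, h1, h2, h3⟩ :=
        Dense.exists_seq_strictAnti_tendsto_of_lt
          (Rat.isDenseEmbedding_coe_real.dense : Dense (Set.range ((↑) : ℚ → ℝ))) ht.2
      refine ⟨fun n => q n, fun _ => ⟨h1, fun n => ?_, fun n => ?_, h3⟩⟩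
      · exact ⟨(h2 n).1.1, (h2 n).1.2⟩
      · exact ⟨⟨ht.1.trans_lt (h2 n).1.1, (h2 n).1.2⟩, (h2 n).2⟩
    · exact ⟨fun _ => 0, fun h => absurd h ht⟩
  choose q hq using hq
  have hqlim : ∀ t ∈ Set.Ico a b, Tendsto (q t) atTop (nhdsWithin t (Set.Ioi t ∩ D)) :=
    fun t ht => tendsto_nhdsWithin_iff.2 ⟨(hq t ht).2.2.2,
      Eventually.of_forall fun n => ⟨((hq t ht).2.1 n).1, (hq t ht).2.2.1 n⟩⟩
  set Wp : ℝ → Ω → ℝ≥0∞ := fun t ω => limsup (fun n => v (q t n) ω) atTop with hWp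
  have hWpm : ∀ t ∈ Set.Ico a b, Measurable[ℱ t] (Wp t) := by
    intro t ht
    have key : ∀ s, t < s → Measurable[ℱ s] (Wp t) := by
      intro s hs
      obtain ⟨N, hN⟩ := eventually_atTop.1 ((hq t ht).2.2.2.eventually (gt_mem_nhds hs))
      have heq : Wp t = fun ω => limsup (fun n => v (q t (n + N)) ω) atTop := by
        ext ω
        exact (limsup_nat_add (fun n => v (q t n) ω) N).symm
      rw [heq]
      refine Measurable.limsup (mδ := ℱ s) fun n => ?_
      exact (hv _ (hDI ((hq t ht).2.2.1 _))).mono (ℱ.mono (hN _ (Nat.le_add_left _ _)).le) le_rfl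
    intro A hA
    rw [hrc t]
    simp only [MeasurableSpace.measurableSet_iInf]
    exact fun s hs => key s hs hA
  obtain ⟨Q, hQc, hQd, hQ0, hQt⟩ := ENNReal.exists_countable_dense_no_zero_top
  have hosc : ∀ᵐ ω ∂μ, ∀ l ∈ Q, ∀ u ∈ Q, l < u → ∃ n, ¬ AltHit l u (2 * n) D (v · ω) := by
    rw [ae_ball_iff hQc]
    intro l hl
    rw [ae_ball_iff hQc]
    intro u hu
    by_cases hlu : l < u
    · filter_upwards [ae_exists_not_altHit hab.le hv hsup hDc hDI hlu
        (fun h => hQt (h ▸ hu))] with ω h _ using h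
    · exact Eventually.of_forall fun ω h => absurd h hlu
  have hright : ∀ᵐ ω ∂μ, ∀ t ∈ Set.Ico a b, Wp t ω ≠ ∞ ∧
      Tendsto (v · ω) (nhdsWithin t (Set.Ioi t ∩ D)) (nhds (Wp t ω)) := by
    filter_upwards [hosc, ae_bddAbove_of_condLe hab.le hv hsup hfin hDc hDI] with ω h1 h2 t ht
    obtain ⟨n, hn⟩ := h2
    obtain ⟨L, hL⟩ := exists_tendsto_nhdsWithin_Ioi_inter (t := t) hQd h1
    have := (hL.comp (hqlim t ht)).limsup_eq
    have hLW : Wp t ω = L := this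
    rw [hLW]
    refine ⟨ne_top_of_le_ne_top (ENNReal.natCast_ne_top n) ?_, hL⟩
    exact le_of_tendsto' (hL.comp (hqlim t ht)) fun k => hn _ ((hq t ht).2.2.1 k)
  refine ⟨fun t ω => (Wp t ω).toReal, fun t ht => ENNReal.measurable_toReal.comp (hWpm t ht),
    fun _ _ => ENNReal.toReal_nonneg, fun t ht => ?_, ?_⟩
  · refine ⟨q t, (hq t ht).2.1, (hq t ht).2.2.2, ?_⟩
    filter_upwards [hright] with ω h
    rw [ENNReal.ofReal_toReal (h t ht).1]
    exact (h t ht).2.comp (hqlim t ht)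
  · filter_upwards [hright, hosc, ae_bddAbove_of_condLe hab.le hv hsup hfin hDc hDI]
      with ω h h1 h2
    have hr : ∀ t ∈ Set.Ico a b,
        Tendsto (fun s => (v s ω).toReal) (nhdsWithin t (Set.Ioi t ∩ D))
          (nhds (Wp t ω).toReal) :=
      fun t ht => (ENNReal.tendsto_toReal (h t ht).1).comp (h t ht).2
    refine ⟨fun t ht => tendsto_nhdsGT_of_tendsto_inter hDd ht (hr t ht) hr, fun t ht => ?_⟩
    obtain ⟨L, hL⟩ := exists_tendsto_nhdsWithin_Iio_inter (t := t) hQd h1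
    obtain ⟨n, hn⟩ := h2
    have hne : (nhdsWithin t (Set.Iio t ∩ D)).NeBot := by
      refine ⟨fun hbot => ?_⟩
      have : ∀ᶠ y in nhdsWithin t (Set.Iio t ∩ D), False := by rw [hbot]; simp
      obtain ⟨c, hc, h⟩ := eventually_nhdsWithin_Iio_inter.1 this
      obtain ⟨y, hyD, hy⟩ := hDd (max c a) t (max_lt hc ht.1)
        ⟨le_max_right _ _, (max_lt hc ht.1).trans_le ht.2⟩
      exact h y ⟨(le_max_left _ _).trans_lt hy.1, hy.2⟩ hyD
    have hLn : L ≤ n := le_of_tendsto hL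
      (eventually_nhdsWithin_Iio_inter.2 ⟨t - 1, by linarith, fun y _ hy => hn y hy⟩)
    exact ⟨L.toReal, tendsto_nhdsLT_of_tendsto_inter hDd ht
      ((ENNReal.tendsto_toReal (ne_top_of_le_ne_top (ENNReal.natCast_ne_top n) hLn)).comp hL) hr⟩

end RightLimit

section Processes

variable {m0 : MeasurableSpace Ω} {μ : Measure Ω} {T : ℝ} {ℱ : Filtration ℝ m0}
  {X Y : ℝ → Ω → ℝ}

theorem PosProc.measurable (hX : PosProc μ T ℱ X) {t : ℝ} (ht : t ∈ Set.Icc 0 T) :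
    Measurable (X t) :=
  (hX.1 t ht).measurable.mono (ℱ.le t) le_rfl

theorem PosProc.mul (hX : PosProc μ T ℱ X) (hY : PosProc μ T ℱ Y) :
    PosProc μ T ℱ (fun t ω => X t ω * Y t ω) := by
  refine ⟨fun t ht => (hX.1 t ht).mul (hY.1 t ht), ?_, ?_⟩
  · filter_upwards [hX.2.1, hY.2.1] with ω h1 h2 t ht using mul_nonneg (h1 t ht) (h2 t ht)
  · filter_upwards [hX.2.2, hY.2.2] with ω h1 h2 using h1.mul h2

theorem PosProc.ae_nonneg (hX : PosProc μ T ℱ X) {t : ℝ} (ht : t ∈ Set.Icc 0 T) :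
    0 ≤ᵐ[μ] X t := by
  filter_upwards [hX.2.1] with ω h using h t ht

theorem SuperMG.condLe [IsFiniteMeasure μ] (hX : SuperMG μ T ℱ X) {s t : ℝ}
    (hs : s ∈ Set.Icc 0 T) (ht : t ∈ Set.Icc 0 T) (hst : s ≤ t) :
    CondLe μ (ℱ s) (fun ω => ENNReal.ofReal (X t ω)) (fun ω => ENNReal.ofReal (X s ω)) :=
  CondLe.of_condExp_le (ℱ.le s) (hX.2.1 t ht) (hX.2.1 s hs) (hX.1.ae_nonneg ht)
    (hX.1.ae_nonneg hs) (hX.2.2 s t hs ht hst)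

theorem PosProc.superMG_of_condLe [IsFiniteMeasure μ] (hX : PosProc μ T ℱ X)
    (h0 : ∫⁻ ω, ENNReal.ofReal (X 0 ω) ∂μ ≠ ∞)
    (h : ∀ s t, s ∈ Set.Icc 0 T → t ∈ Set.Icc 0 T → s ≤ t →
      CondLe μ (ℱ s) (fun ω => ENNReal.ofReal (X t ω)) (fun ω => ENNReal.ofReal (X s ω))) :
    SuperMG μ T ℱ X := by
  have hint : ∀ t ∈ Set.Icc 0 T, Integrable (X t) μ := by
    intro t ht
    refine (lintegral_ofReal_ne_top_iff_integrable (hX.measurable ht).aestronglyMeasurable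
      (hX.ae_nonneg ht)).1 (ne_top_of_le_ne_top h0 ?_)
    exact (h 0 t ⟨le_rfl, ht.1.trans ht.2⟩ ht ht.1).lintegral_le
  exact ⟨hX, hint, fun s t hs ht hst => CondLe.condExp_le (ℱ.le s) (hint t ht) (hint s hs)
    (hX.1 s hs) (hX.ae_nonneg ht) (hX.ae_nonneg hs) (h s t hs ht hst)⟩

theorem S1mem.lintegral_le [IsProbabilityMeasure μ] (hX : S1mem μ T ℱ X) {t : ℝ}
    (ht : t ∈ Set.Icc 0 T) : ∫⁻ ω, ENNReal.ofReal (X t ω) ∂μ ≤ 1 := by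
  refine (hX.1.condLe ⟨le_rfl, ht.1.trans ht.2⟩ ht ht.1).lintegral_le.trans ?_
  calc ∫⁻ ω, ENNReal.ofReal (X 0 ω) ∂μ ≤ ∫⁻ _, 1 ∂μ := by
        refine lintegral_mono_ae ?_
        filter_upwards [hX.2] with ω h using by simpa using ENNReal.ofReal_le_ofReal h
    _ = 1 := by simp

theorem CondLe.ae_eq_zero [IsFiniteMeasure μ] {m : MeasurableSpace Ω} (hm : m ≤ m0)
    {U V : Ω → ℝ≥0∞} (hU : Measurable[m0] U) (hV : Measurable[m] V) (h : CondLe μ m U V) :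
    ∀ᵐ ω ∂μ, V ω = 0 → U ω = 0 := by
  have hA : MeasurableSet[m] {ω | V ω = 0} := hV (measurableSet_singleton 0)
  have h1 := h _ hA
  rw [setLIntegral_congr_fun (hm _ hA) (g := fun _ => 0) fun ω hω => hω] at h1
  simp only [lintegral_const, zero_mul, nonpos_iff_eq_zero] at h1
  rw [setLIntegral_eq_zero_iff (hm _ hA) hU] at h1
  exact h1

theorem SuperMG.ae_eq_zero [IsFiniteMeasure μ] (hX : SuperMG μ T ℱ X) {s t : ℝ}
    (hs : s ∈ Set.Icc 0 T) (ht : t ∈ Set.Icc 0 T) (hst : s ≤ t) :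
    ∀ᵐ ω ∂μ, X s ω = 0 → X t ω = 0 := by
  filter_upwards [(hX.condLe hs ht hst).ae_eq_zero (ℱ.le s) (hX.1.measurable ht).ennreal_ofReal
    (hX.1.1 s hs).measurable.ennreal_ofReal, hX.1.2.1] with ω h1 h2 h3
  exact le_antisymm (ENNReal.ofReal_eq_zero.1 (h1 (by simp [h3]))) (h2 t ht)

theorem SuperMG.ae_pos [IsFiniteMeasure μ] (hX : SuperMG μ T ℱ X)
    (hpos : ∀ᵐ ω ∂μ, 0 < X T ω) {t : ℝ} (ht : t ∈ Set.Icc 0 T) : ∀ᵐ ω ∂μ, 0 < X t ω := by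
  filter_upwards [hX.ae_eq_zero ht ⟨ht.1.trans ht.2, le_rfl⟩ ht.2, hpos, hX.1.2.1] with ω h1 h2 h3
  exact lt_of_le_of_ne (h3 t ht) fun h => h2.ne' (h1 h.symm)

theorem SuperMG.ae_exists_lower_bound [IsProbabilityMeasure μ] (hT : 0 < T)
    (hX : SuperMG μ T ℱ X) (hpos : ∀ᵐ ω ∂μ, 0 < X T ω) :
    ∀ᵐ ω ∂μ, ∃ ε > 0, ∀ t ∈ Set.Icc 0 T, ε ≤ X t ω := by
  set D : Set ℝ := Set.Ioo 0 T ∩ Set.range ((↑) : ℚ → ℝ) with hD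
  have hDc : D.Countable := (Set.countable_range _).mono Set.inter_subset_right
  have hDI : D ⊆ Set.Icc 0 T := fun x hx => ⟨hx.1.1.le, hx.1.2.le⟩
  have h := ae_pos_of_condLe (μ := μ) (ℱ := ℱ) (v := fun t ω => ENNReal.ofReal (X t ω)) hT.le
    (fun t ht => (hX.1.1 t ht).measurable.ennreal_ofReal)
    (fun s hs t ht => hX.condLe hs ht) (by simpa using hpos) hDc hDI
  filter_upwards [h, hpos, hX.1.2.2] with ω ⟨n, hn⟩ h2 h3
  have hn' : ∀ s ∈ D, ((n + 1 : ℕ) : ℝ)⁻¹ ≤ X s ω := by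
    intro s hs
    have := hn s hs
    rw [← ENNReal.ofReal_natCast, ← ENNReal.ofReal_inv_of_pos (by positivity)] at this
    exact (ENNReal.ofReal_le_ofReal_iff' (p := ((n + 1 : ℕ) : ℝ)⁻¹)).1 this |>.resolve_right
      (by simp; positivity)
  refine ⟨min ((n + 1 : ℕ) : ℝ)⁻¹ (X T ω), lt_min (by positivity) h2, fun t ht => ?_⟩
  rcases ht.2.eq_or_lt with rfl | htT
  · exact min_le_right _ _
  · refine (min_le_left _ _).trans ?_
    have hne : (nhdsWithin t (Set.Ioi t ∩ D)).NeBot :=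
      neBot_nhdsWithin_Ioi_inter (a := 0) (b := T) (fun x y => exists_rat_mem_Ioo_inter) ⟨ht.1, htT⟩
    exact ge_of_tendsto ((h3.1 t ⟨ht.1, htT⟩).mono_left (nhdsWithin_mono _ Set.inter_subset_left))
      (eventually_nhdsWithin_Ioi_inter.2 ⟨t + 1, by simp, fun y _ hy => hn' y hy⟩)

theorem condLe_glue {v : ℝ → Ω → ℝ≥0∞} {I : Set ℝ} {c : ℝ} (hc : c ∈ I)
    (h1 : ∀ s ∈ I, ∀ t ∈ I, s ≤ t → t ≤ c → CondLe μ (ℱ s) (v t) (v s))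
    (h2 : ∀ s ∈ I, ∀ t ∈ I, s ≤ t → c ≤ s → CondLe μ (ℱ s) (v t) (v s)) :
    ∀ s ∈ I, ∀ t ∈ I, s ≤ t → CondLe μ (ℱ s) (v t) (v s) := by
  intro s hs t ht hst
  rcases le_total c s with hcs | hsc
  · exact h2 s hs t ht hst hcs
  · rcases le_total t c with htc | hct
    · exact h1 s hs t ht hst htc
    · exact ((h2 c hc t ht hct le_rfl).mono (ℱ.mono hsc)).trans (h1 s hs c hc hsc le_rfl)

end Processes

section Polar

variable {m0 : MeasurableSpace Ω} {μ : Measure Ω} {T : ℝ}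
  {ℱ : Filtration ℝ m0} {C : Set (ℝ → Ω → ℝ)} {t₁ t₂ : ℝ}

theorem incr_mem_incrSet {X : ℝ → Ω → ℝ} (hX : PosProc μ T ℱ X) (hXC : X ∈ C)
    (ht₁ : t₁ ∈ Set.Icc 0 T) (ht₂ : t₂ ∈ Set.Icc 0 T) (h12 : t₁ ≤ t₂) :
    (fun ω => X t₂ ω / X t₁ ω) ∈ incrSet μ ℱ t₁ t₂ C := by
  refine ⟨?_, ?_, X, hXC, Filter.EventuallyEq.rfl⟩
  · exact (hX.1 t₂ ht₂).div ((hX.1 t₁ ht₁).mono (ℱ.mono h12))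
  · filter_upwards [hX.2.1] with ω h using div_nonneg (h _ ht₂) (h _ ht₁)

variable [IsProbabilityMeasure μ]

theorem ae_econd_le_one_iff (s : ℝ) {f : Ω → ℝ} (hf : Measurable f) (hf0 : 0 ≤ᵐ[μ] f) :
    (∀ᵐ ω ∂μ, econd μ (ℱ s) f ω ≤ 1) ↔
      CondLe μ (ℱ s) (fun ω => ENNReal.ofReal (f ω)) (fun _ => 1) := by
  have hint : ∀ n : ℕ, Integrable (fun ω => min (f ω) n) μ := by
    intro n
    refine Integrable.of_bound (hf.min measurable_const).aestronglyMeasurable (n : ℝ) ?_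
    filter_upwards [hf0] with ω h
    rw [Real.norm_of_nonneg (le_min h (Nat.cast_nonneg n))]
    exact min_le_right _ _
  have h0 : ∀ n : ℕ, 0 ≤ᵐ[μ] fun ω => min (f ω) n := by
    intro n
    filter_upwards [hf0] with ω h using le_min h (Nat.cast_nonneg n)
  constructor
  · intro h
    refine CondLe.of_tendsto (u := fun n ω => ENNReal.ofReal (min (f ω) n))
      (fun n => (hf.min measurable_const).ennreal_ofReal.aemeasurable) (fun n => ?_) ?_
    · have := CondLe.of_condExp_le (ℱ.le s) (hint n) (integrable_const (1 : ℝ)) (h0 n)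
        (Eventually.of_forall fun _ => zero_le_one) ?_
      · simpa using this
      · filter_upwards [h] with ω hω
        have := (le_iSup
          (fun n : ℕ => ENNReal.ofReal ((μ[fun ω' => min (f ω') n | ℱ s]) ω)) n).trans hω
        simpa using this
    · refine Eventually.of_forall fun ω => ?_
      obtain ⟨N, hN⟩ := exists_nat_ge (f ω)
      refine tendsto_const_nhds.congr' ?_
      filter_upwards [eventually_ge_atTop N] with n hn
      rw [min_eq_left (hN.trans (by exact_mod_cast hn))]
  · intro h
    have : ∀ n : ℕ, μ[fun ω' => min (f ω') n | ℱ s] ≤ᵐ[μ] fun _ => 1 := by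
      intro n
      refine CondLe.condExp_le (ℱ.le s) (hint n) (integrable_const (1 : ℝ))
        stronglyMeasurable_const (h0 n) (Eventually.of_forall fun _ => zero_le_one) ?_
      refine (CondLe.of_ae_le (Eventually.of_forall fun ω => ?_)).trans (V := fun ω =>
        ENNReal.ofReal (f ω)) (by simpa using h)
      exact ENNReal.ofReal_le_ofReal (min_le_left _ _)
    filter_upwards [ae_all_iff.2 this] with ω hω
    exact iSup_le fun n => by simpa using hω n

theorem condLe_of_mem_condPolarAt (hC : ∀ X ∈ C, S1mem μ T ℱ X)
    (ht₁ : t₁ ∈ Set.Icc 0 T) (ht₂ : t₂ ∈ Set.Icc 0 T) (h12 : t₁ ≤ t₂)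
    {g : Ω → ℝ} (hg : g ∈ condPolarAt μ ℱ t₁ t₂ (incrSet μ ℱ t₁ t₂ C))
    {X : ℝ → Ω → ℝ} (hX : X ∈ C) :
    CondLe μ (ℱ t₁) (fun ω => ENNReal.ofReal (g ω * X t₂ ω))
      (fun ω => ENNReal.ofReal (X t₁ ω)) := by
  have hS := (hC X hX).1
  have hf := incr_mem_incrSet hS.1 hX ht₁ ht₂ h12
  have hfm : Measurable fun ω => X t₂ ω / X t₁ ω := hf.1.measurable.mono (ℱ.le t₂) le_rfl
  have hgm : Measurable g := hg.1.measurable.mono (ℱ.le t₂) le_rfl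
  have h1 := (ae_econd_le_one_iff t₁ (hfm.mul hgm)
    (by filter_upwards [hf.2.1, hg.2.1] with ω h h' using mul_nonneg h h')).1 (hg.2.2 _ hf)
  refine (h1.mul_left (ℱ.le t₁) (hfm.mul hgm).ennreal_ofReal.aemeasurable aemeasurable_const
    (hS.1.1 t₁ ht₁).measurable.ennreal_ofReal).congr ?_ (by simp)
  filter_upwards [hS.ae_eq_zero ht₁ ht₂ h12, hS.1.2.1] with ω h2 h3
  simp only [Pi.mul_apply]
  rw [← ENNReal.ofReal_mul (h3 t₁ ht₁)]
  by_cases h : X t₁ ω = 0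
  · simp [h, h2 h]
  · congr 1; field_simp

theorem incrSet_procPolar_subset_condPolarAt
    (hC : ∀ X ∈ C, S1mem μ T ℱ X)
    (ht₁ : t₁ ∈ Set.Icc 0 T) (ht₂ : t₂ ∈ Set.Icc 0 T) (h12 : t₁ ≤ t₂) :
    incrSet μ ℱ t₁ t₂ (procPolar μ T ℱ C) ⊆ condPolarAt μ ℱ t₁ t₂ (incrSet μ ℱ t₁ t₂ C) := by
  rintro g ⟨hgm, hg0, Y, hY, hgY⟩
  refine ⟨hgm, hg0, fun f hf => ?_⟩
  obtain ⟨hfm, hf0, X, hX, hfX⟩ := hf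
  have hXP := (hC X hX).1.1
  have hfm' : Measurable f := hfm.measurable.mono (ℱ.le t₂) le_rfl
  have hgm' : Measurable g := hgm.measurable.mono (ℱ.le t₂) le_rfl
  refine (ae_econd_le_one_iff t₁ (hfm'.mul hgm') ?_).2 ?_
  · filter_upwards [hf0, hg0] with ω h h' using mul_nonneg h h'
  · have hZ := (hY.2 X hX).1
    have hZ1 : Measurable[ℱ t₁] fun ω => X t₁ ω * Y t₁ ω := (hZ.1.1 t₁ ht₁).measurable
    refine ((hZ.condLe ht₁ ht₂ h12).mul_left (ℱ.le t₁)
      (hZ.1.measurable ht₂).ennreal_ofReal.aemeasurable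
      (hZ.1.measurable ht₁).ennreal_ofReal.aemeasurable
      (f := fun ω => ENNReal.ofReal (X t₁ ω * Y t₁ ω)⁻¹) hZ1.inv.ennreal_ofReal).trans
      (CondLe.of_ae_le ?_) |> (CondLe.of_ae_le ?_).trans
    · filter_upwards [hXP.2.1, hY.1.2.1, hfX, hgY] with ω h1 h2 h3 h4
      simp only [Pi.mul_apply]
      rw [← ENNReal.ofReal_mul (inv_nonneg.2 (mul_nonneg (h1 _ ht₁) (h2 _ ht₁))), h3, h4]
      refine le_of_eq ?_
      congr 1
      rw [mul_inv]
      ring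
    · filter_upwards [hXP.2.1, hY.1.2.1] with ω h1 h2
      rw [← ENNReal.ofReal_mul (inv_nonneg.2 (mul_nonneg (h1 _ ht₁) (h2 _ ht₁)))]
      exact ENNReal.ofReal_le_one.2 (inv_mul_le_one_of_le₀ le_rfl
        (mul_nonneg (h1 _ ht₁) (h2 _ ht₁)))

end Polar

section DualEnvelope

variable {m0 : MeasurableSpace Ω} {μ : Measure Ω} {T : ℝ}
  {ℱ : Filtration ℝ m0} {C : Set (ℝ → Ω → ℝ)} {t₁ t₂ : ℝ}

/-- The process that follows `X` up to time `s` and the increments of `X'` afterwards. -/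
noncomputable def switchAt (s : ℝ) (X X' : ℝ → Ω → ℝ) : ℝ → Ω → ℝ :=
  fun t ω => if t < s then X t ω else X s ω * (X' t ω / X' s ω)

theorem ForkConvex.switchAt_mem (hfork : ForkConvex μ T ℱ C) {s : ℝ} (hs : s ∈ Set.Icc 0 T)
    {X X' : ℝ → Ω → ℝ} (hX : X ∈ C) (hX' : X' ∈ C) : switchAt s X X' ∈ C := by
  convert hfork s hs (fun _ => 1) stronglyMeasurable_const (fun _ => zero_le_one)
    (fun _ => le_rfl) X hX X' hX' X' hX' using 1
  ext t ω
  simp [switchAt]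

variable [IsProbabilityMeasure μ]

/-- The conditional envelope at intermediate times of the increments of `C` up to `t₂`, weighted
by `g`. -/
theorem exists_dualEnvelope (hC : ∀ X ∈ C, S1mem μ T ℱ X) (hfork : ForkConvex μ T ℱ C)
    (ht₁ : t₁ ∈ Set.Icc 0 T) (ht₂ : t₂ ∈ Set.Icc 0 T) (h12 : t₁ ≤ t₂)
    {Y : ℝ → Ω → ℝ} (hY : Y ∈ C) (hpos : ∀ᵐ ω ∂μ, 0 < Y T ω)
    {g : Ω → ℝ} (hg : Measurable g)
    (hgC : ∀ X ∈ C, CondLe μ (ℱ t₁) (fun ω => ENNReal.ofReal (g ω * X t₂ ω))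
      (fun ω => ENNReal.ofReal (X t₁ ω))) :
    ∃ W : ℝ → Ω → ℝ≥0∞, (∀ t ∈ Set.Icc t₁ t₂, Measurable[ℱ t] (W t)) ∧
      (∀ X ∈ C, ∀ s ∈ Set.Icc t₁ t₂, ∀ t ∈ Set.Icc t₁ t₂, s ≤ t →
        CondLe μ (ℱ s) (fun ω => ENNReal.ofReal (X t ω / Y t ω) * W t ω)
          (fun ω => ENNReal.ofReal (X s ω / Y s ω) * W s ω)) ∧
      (∀ X ∈ C, ∀ s ∈ Set.Icc t₁ t₂, CondLe μ (ℱ s) (fun ω => ENNReal.ofReal (g ω * X t₂ ω))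
          (fun ω => ENNReal.ofReal (X s ω / Y s ω) * W s ω)) ∧
      W t₁ ≤ᵐ[μ] fun ω => ENNReal.ofReal (Y t₁ ω) := by
  classical
  have hI : ∀ {t}, t ∈ Set.Icc t₁ t₂ → t ∈ Set.Icc 0 T :=
    fun ht => ⟨ht₁.1.trans ht.1, ht.2.trans ht₂.2⟩
  have hYpos : ∀ t ∈ Set.Icc t₁ t₂, ∀ᵐ ω ∂μ, 0 < Y t ω :=
    fun t ht => (hC Y hY).1.ae_pos hpos (hI ht)
  set U : ℝ → (ℝ → Ω → ℝ) → Ω → ℝ≥0∞ :=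
    fun t X ω => ENNReal.ofReal (g ω * (Y t ω * (X t₂ ω / X t ω))) with hU
  have hUm : ∀ t ∈ Set.Icc t₁ t₂, ∀ X ∈ C, Measurable (U t X) := fun t ht X hX =>
    (hg.mul (((hC Y hY).1.1.measurable (hI ht)).mul (((hC X hX).1.1.measurable ht₂).div
      ((hC X hX).1.1.measurable (hI ht))))).ennreal_ofReal
  have hUswitch : ∀ t ∈ Set.Icc t₁ t₂, ∀ X, U t X =
      fun ω => ENNReal.ofReal (g ω * switchAt t Y X t₂ ω) := by
    intro t ht X
    simp only [hU, switchAt, if_neg ht.2.not_gt]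
  have hUbd : ∀ t ∈ Set.Icc t₁ t₂, ∀ X ∈ C, ∫⁻ ω, U t X ω ∂μ ≤ 1 := by
    intro t ht X hX
    have hF := hfork.switchAt_mem (hI ht) hY hX
    rw [hUswitch t ht X]
    exact (hgC _ hF).lintegral_le.trans ((hC _ hF).lintegral_le ht₁)
  have hEnv : ∀ t, ∃ W : Ω → ℝ≥0∞, t ∈ Set.Icc t₁ t₂ → Measurable[ℱ t] W ∧
      (∀ X ∈ C, CondLe μ (ℱ t) (U t X) W) ∧
      ∃ X : ℕ → ℝ → Ω → ℝ, (∀ n, X n ∈ C) ∧ ∃ k : ℕ → Ω → ℝ≥0∞, (∀ n, Measurable[ℱ t] (k n)) ∧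
        (∀ n, CondLe μ (ℱ t) (k n) (U t (X n))) ∧
        ∀ᵐ ω ∂μ, Tendsto (fun n => k n ω) atTop (nhds (W ω)) := by
    intro t
    by_cases ht : t ∈ Set.Icc t₁ t₂
    · have hpaste : ∀ V ∈ U t '' C, ∀ V' ∈ U t '' C, ∀ A, MeasurableSet[ℱ t] A →
          ∃ K ∈ U t '' C, (∀ᵐ ω ∂μ, ω ∈ A → K ω = V ω) ∧ (∀ᵐ ω ∂μ, ω ∉ A → K ω = V' ω) := by
        rintro _ ⟨X, hX, rfl⟩ _ ⟨X', hX', rfl⟩ A hA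
        have hF := hfork t (hI ht) (A.indicator fun _ => 1)
          (stronglyMeasurable_const.indicator hA)
          (fun ω => Set.indicator_nonneg (fun _ _ => zero_le_one) _)
          (fun ω => Set.indicator_le_self' (fun _ _ => zero_le_one) _) Y hY X hX X' hX'
        refine ⟨_, ⟨_, hF, rfl⟩, ?_, ?_⟩
        · filter_upwards [hYpos t ht] with ω hω hωA
          simp only [hU, lt_irrefl, if_false, if_neg ht.2.not_gt, Set.indicator_of_mem hωA]
          by_cases h : X t ω = 0
          · simp [h]
          · congr 2; field_simp; simp
        · filter_upwards [hYpos t ht] with ω hω hωA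
          simp only [hU, lt_irrefl, if_false, if_neg ht.2.not_gt, Set.indicator_of_notMem hωA]
          by_cases h : X' t ω = 0
          · simp [h]
          · congr 2; field_simp; simp
      obtain ⟨W, hWm, hW, V, hV, k, hk⟩ := exists_esssup_condLExp (μ := μ) (ℱ.le t) (U t '' C)
        ⟨_, Y, hY, rfl⟩ (by rintro _ ⟨X, hX, rfl⟩; exact hUbd t ht X hX) hpaste
      choose X hXC hXV using hV
      refine ⟨W, fun _ => ⟨hWm, fun X hX => hW _ ⟨X, hX, rfl⟩, X, hXC, k, hk.1,
        fun n => ?_, hk.2.2⟩⟩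
      rw [hXV]
      exact hk.2.1 n
    · exact ⟨0, fun h => absurd h ht⟩
  choose W hW using hEnv
  have hR : ∀ X ∈ C, ∀ t ∈ Set.Icc t₁ t₂,
      Measurable[ℱ t] fun ω => ENNReal.ofReal (X t ω / Y t ω) := fun X hX t ht =>
    (((hC X hX).1.1.1 t (hI ht)).measurable.div
      ((hC Y hY).1.1.1 t (hI ht)).measurable).ennreal_ofReal
  have hWle : ∀ X ∈ C, ∀ X' ∈ C, ∀ s ∈ Set.Icc t₁ t₂,
      CondLe μ (ℱ s) (fun ω => ENNReal.ofReal (X s ω / Y s ω) * U s X' ω)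
        (fun ω => ENNReal.ofReal (X s ω / Y s ω) * W s ω) := fun X hX X' hX' s hs =>
    ((hW s hs).2.1 X' hX').mul_left (ℱ.le s) (hUm s hs X' hX').aemeasurable
      ((hW s hs).1.mono (ℱ.le s) le_rfl).aemeasurable (hR X hX s hs)
  refine ⟨W, fun t ht => (hW t ht).1, ?_, ?_, ?_⟩
  · intro X hX s hs t ht hst
    rcases hst.eq_or_lt with rfl | hst'
    · exact CondLe.of_ae_le (Filter.EventuallyLE.refl _ _)
    obtain ⟨-, -, X', hX', k, hkm, hk, hlim⟩ := hW t ht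
    have hkm0 : ∀ n, Measurable (k n) := fun n => (hkm n).mono (ℱ.le t) le_rfl
    refine CondLe.of_tendsto (u := fun n ω => ENNReal.ofReal (X t ω / Y t ω) * k n ω)
      (fun n => (((hR X hX t ht).mono (ℱ.le t) le_rfl).mul (hkm0 n)).aemeasurable)
      (fun n => ?_) ?_
    · have hF := hfork.switchAt_mem (hI ht) hX (hX' n)
      refine (((hk n).mul_left (ℱ.le t) (hkm0 n).aemeasurable
        (hUm t ht _ (hX' n)).aemeasurable (hR X hX t ht)).mono (ℱ.mono hst)).trans
        ((CondLe.of_ae_le ?_).trans (hWle X hX _ hF s hs))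
      filter_upwards [hYpos t ht, hYpos s hs, (hC X hX).1.1.2.1,
        (hC X hX).1.ae_eq_zero (hI hs) (hI ht) hst] with ω h1 h2 h3 h4
      refine le_of_eq ?_
      simp only [hU, switchAt, if_pos hst', if_neg ht.2.not_gt]
      rw [← ENNReal.ofReal_mul (div_nonneg (h3 t (hI ht)) h1.le),
        ← ENNReal.ofReal_mul (div_nonneg (h3 s (hI hs)) h2.le)]
      congr 1
      by_cases h : X s ω = 0
      · simp [h, h4 h]
      · field_simp
    · filter_upwards [hlim] with ω h
      exact ENNReal.Tendsto.const_mul h (Or.inr ENNReal.ofReal_ne_top)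
  · intro X hX s hs
    refine (CondLe.of_ae_le ?_).trans (hWle X hX X hX s hs)
    filter_upwards [hYpos s hs, (hC X hX).1.1.2.1,
      (hC X hX).1.ae_eq_zero (hI hs) ht₂ hs.2] with ω h2 h3 h4
    refine le_of_eq ?_
    simp only [hU]
    rw [← ENNReal.ofReal_mul (div_nonneg (h3 s (hI hs)) h2.le)]
    congr 1
    by_cases h : X s ω = 0
    · simp [h, h4 h]
    · field_simp
  · have ht : t₁ ∈ Set.Icc t₁ t₂ := ⟨le_rfl, h12⟩
    obtain ⟨hWm, -, X', hX', k, hkm, hk, hlim⟩ := hW t₁ ht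
    refine CondLe.ae_le (ℱ.le t₁) hWm
      ((hC Y hY).1.1.1 t₁ ht₁).measurable.ennreal_ofReal ?_
    refine CondLe.of_tendsto (fun n => ((hkm n).mono (ℱ.le t₁) le_rfl).aemeasurable)
      (fun n => (hk n).trans ?_) hlim
    rw [hUswitch t₁ ht]
    refine (hgC _ (hfork.switchAt_mem ht₁ hY (hX' n))).trans (CondLe.of_ae_le ?_)
    filter_upwards [hYpos t₁ ht] with ω hω
    refine ENNReal.ofReal_le_ofReal ?_
    simp only [switchAt, lt_irrefl, if_false]
    exact mul_le_of_le_one_right hω.le (div_self_le_one _)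

end DualEnvelope

section DualProcess

variable {m0 : MeasurableSpace Ω} {μ : Measure Ω} {T : ℝ}
  {ℱ : Filtration ℝ m0} {C : Set (ℝ → Ω → ℝ)} {t₁ t₂ : ℝ}

/-- The process equal to `1` before `t₁`, to `ψ` on `[t₁, t₂)`, and to `g` from `t₂` on. -/
noncomputable def spliceProc (t₁ t₂ : ℝ) (ψ : ℝ → Ω → ℝ) (g : Ω → ℝ) : ℝ → Ω → ℝ :=
  fun t ω => if t < t₂ then if t < t₁ then 1 else ψ t ω else g ω

theorem posProc_spliceProc {ψ : ℝ → Ω → ℝ} {g : Ω → ℝ}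
    (hψ : ∀ t ∈ Set.Ico t₁ t₂, Measurable[ℱ t] (ψ t)) (hg : Measurable[ℱ t₂] g)
    (hψ0 : ∀ᵐ ω ∂μ, ∀ t ∈ Set.Ico t₁ t₂, 0 ≤ ψ t ω) (hg0 : 0 ≤ᵐ[μ] g)
    (hψr : ∀ᵐ ω ∂μ, ∀ t ∈ Set.Ico t₁ t₂,
      Tendsto (ψ · ω) (nhdsWithin t (Set.Ioi t)) (nhds (ψ t ω)))
    (hψl : ∀ᵐ ω ∂μ, ∀ t ∈ Set.Ioc t₁ t₂,
      ∃ L, Tendsto (ψ · ω) (nhdsWithin t (Set.Iio t)) (nhds L)) :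
    PosProc μ T ℱ (spliceProc t₁ t₂ ψ g) := by
  refine ⟨fun t ht => ?_, ?_, ?_⟩
  · by_cases h2 : t < t₂
    · by_cases h1 : t < t₁
      · have : spliceProc t₁ t₂ ψ g t = fun _ => 1 := by ext ω; simp [spliceProc, h2, h1]
        rw [this]
        exact stronglyMeasurable_const
      · have : spliceProc t₁ t₂ ψ g t = ψ t := by ext ω; simp [spliceProc, h2, h1]
        rw [this]
        exact (hψ t ⟨not_lt.1 h1, h2⟩).stronglyMeasurable
    · have : spliceProc t₁ t₂ ψ g t = g := by ext ω; simp [spliceProc, h2]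
      rw [this]
      exact (hg.mono (ℱ.mono (not_lt.1 h2)) le_rfl).stronglyMeasurable
  · filter_upwards [hψ0, hg0] with ω h h' t _
    simp only [spliceProc]
    split_ifs with h2 h1
    · exact zero_le_one
    · exact h t ⟨not_lt.1 h1, h2⟩
    · exact h'
  · filter_upwards [hψr, hψl] with ω hr hl
    have hin : CadlagOn t₂ (fun t => if t < t₁ then 1 else ψ t ω) :=
      cadlagOn_ite (fun _ _ _ => tendsto_const_nhds) (fun _ _ _ => ⟨1, tendsto_const_nhds⟩)
        (fun t ht h => hr t ⟨h, ht.2⟩) (fun t ht h => hl t ⟨h, ht.2⟩)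
    exact cadlagOn_ite (fun t ht h => hin.1 t ⟨ht.1, h⟩) (fun t ht h => hin.2 t ⟨ht.1, h⟩)
      (fun _ _ _ => tendsto_const_nhds) (fun _ _ _ => ⟨_, tendsto_const_nhds⟩)

variable [IsProbabilityMeasure μ]

theorem condPolarAt_subset_incrSet_procPolar (hT : 0 < T)
    (hrc : ∀ t : ℝ, (ℱ t : MeasurableSpace Ω) = ⨅ (s : ℝ) (_ : t < s), ℱ s)
    (hC : ∀ X ∈ C, S1mem μ T ℱ X) (hfork : ForkConvex μ T ℱ C) (hfar : FarReaching μ T C)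
    (ht₁ : t₁ ∈ Set.Icc 0 T) (ht₂ : t₂ ∈ Set.Icc 0 T) (h12 : t₁ < t₂) :
    condPolarAt μ ℱ t₁ t₂ (incrSet μ ℱ t₁ t₂ C) ⊆ incrSet μ ℱ t₁ t₂ (procPolar μ T ℱ C) := by
  intro g hg
  obtain ⟨Y, hY, hpos⟩ := hfar
  have hgm : Measurable[ℱ t₂] g := hg.1.measurable
  have hg0 : 0 ≤ᵐ[μ] g := hg.2.1
  have hI : ∀ {t}, t ∈ Set.Icc t₁ t₂ → t ∈ Set.Icc 0 T :=
    fun ht => ⟨ht₁.1.trans ht.1, ht.2.trans ht₂.2⟩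
  have hco : ∀ {t}, t ∈ Set.Ico t₁ t₂ → t ∈ Set.Icc t₁ t₂ := fun ht => ⟨ht.1, ht.2.le⟩
  have hIT : ∀ {t}, t ∈ Set.Ico t₁ t₂ → t ∈ Set.Ico 0 T :=
    fun ht => ⟨ht₁.1.trans ht.1, ht.2.trans_le ht₂.2⟩
  have hYP := (hC Y hY).1.1
  have hYpos : ∀ t ∈ Set.Icc t₁ t₂, ∀ᵐ ω ∂μ, 0 < Y t ω :=
    fun t ht => (hC Y hY).1.ae_pos hpos (hI ht)
  obtain ⟨W, hWm, hWa, hWb, hWc⟩ := exists_dualEnvelope hC hfork ht₁ ht₂ h12.le hY hpos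
    (hgm.mono (ℱ.le t₂) le_rfl)
    (fun X hX => condLe_of_mem_condPolarAt hC ht₁ ht₂ h12.le hg hX)
  have hYW : ∀ t ∈ Set.Icc t₁ t₂,
      (fun ω => ENNReal.ofReal (Y t ω / Y t ω) * W t ω) =ᵐ[μ] W t := by
    intro t ht
    filter_upwards [hYpos t ht] with ω h
    rw [div_self h.ne', ENNReal.ofReal_one, one_mul]
  have hWsup : ∀ s ∈ Set.Icc t₁ t₂, ∀ t ∈ Set.Icc t₁ t₂, s ≤ t → CondLe μ (ℱ s) (W t) (W s) :=
    fun s hs t ht hst => (hWa Y hY s hs t ht hst).congr (hYW t ht) (hYW s hs)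
  have hWfin : ∫⁻ ω, W t₁ ω ∂μ ≠ ∞ := ne_top_of_le_ne_top ENNReal.one_ne_top
    ((lintegral_mono_ae hWc).trans ((hC Y hY).lintegral_le ht₁))
  obtain ⟨Z, hZm, hZ0, hZq, hZpath⟩ := exists_rightLimit_of_condLe hrc h12 hWm hWsup hWfin
  have hRm : ∀ X ∈ C, ∀ t ∈ Set.Icc t₁ t₂,
      Measurable[ℱ t] fun ω => ENNReal.ofReal (X t ω / Y t ω) * W t ω := fun X hX t ht =>
    (((hC X hX).1.1.1 t (hI ht)).measurable.div
      (hYP.1 t (hI ht)).measurable).ennreal_ofReal.mul (hWm t ht)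
  have hVm : ∀ X ∈ C, ∀ t ∈ Set.Ico t₁ t₂,
      Measurable fun ω => ENNReal.ofReal (X t ω / Y t ω * Z t ω) := fun X hX t ht =>
    ((((hC X hX).1.1.measurable (hI (hco ht))).div (hYP.measurable (hI (hco ht)))).mul
      ((hZm t ht).mono (ℱ.le t) le_rfl)).ennreal_ofReal
  have hZq' : ∀ X ∈ C, ∀ t ∈ Set.Ico t₁ t₂, ∃ q : ℕ → ℝ, (∀ n, q n ∈ Set.Ioo t t₂) ∧
      Tendsto q atTop (nhds t) ∧ ∀ᵐ ω ∂μ,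
        Tendsto (fun n => ENNReal.ofReal (X (q n) ω / Y (q n) ω) * W (q n) ω) atTop
          (nhds (ENNReal.ofReal (X t ω / Y t ω * Z t ω))) := by
    intro X hX t ht
    obtain ⟨q, hq, hqt, hlim⟩ := hZq t ht
    refine ⟨q, hq, hqt, ?_⟩
    have hqt' : Tendsto q atTop (nhdsWithin t (Set.Ioi t)) :=
      tendsto_nhdsWithin_iff.2 ⟨hqt, Eventually.of_forall fun n => (hq n).1⟩
    filter_upwards [hlim, hYpos t (hco ht), hYP.2.2, (hC X hX).1.1.2.2, (hC X hX).1.1.2.1]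
      with ω h1 h2 h3 h4 h5
    rw [ENNReal.ofReal_mul (div_nonneg (h5 t (hI (hco ht))) h2.le)]
    exact ENNReal.Tendsto.mul (ENNReal.tendsto_ofReal (((h4.1 t (hIT ht)).comp hqt').div
      ((h3.1 t (hIT ht)).comp hqt') h2.ne')) (Or.inr ENNReal.ofReal_ne_top) h1
      (Or.inr ENNReal.ofReal_ne_top)
  have hleft : ∀ X ∈ C, ∀ r ∈ Set.Icc t₁ t₂, ∀ t ∈ Set.Ico t₁ t₂, r ≤ t →
      CondLe μ (ℱ r) (fun ω => ENNReal.ofReal (X t ω / Y t ω * Z t ω))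
        (fun ω => ENNReal.ofReal (X r ω / Y r ω) * W r ω) := by
    intro X hX r hr t ht hrt
    obtain ⟨q, hq, -, hlim⟩ := hZq' X hX t ht
    have hqI : ∀ n, q n ∈ Set.Icc t₁ t₂ := fun n => ⟨ht.1.trans (hq n).1.le, (hq n).2.le⟩
    exact CondLe.of_tendsto
      (fun n => ((hRm X hX _ (hqI n)).mono (ℱ.le _) le_rfl).aemeasurable)
      (fun n => hWa X hX r hr _ (hqI n) (hrt.trans (hq n).1.le)) hlim
  have hright : ∀ X ∈ C, ∀ s ∈ Set.Ico t₁ t₂, ∀ t > s, ∀ U : Ω → ℝ≥0∞, AEMeasurable U μ →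
      (∀ r ∈ Set.Icc t₁ t₂, r ≤ t →
        CondLe μ (ℱ r) U (fun ω => ENNReal.ofReal (X r ω / Y r ω) * W r ω)) →
      CondLe μ (ℱ s) U (fun ω => ENNReal.ofReal (X s ω / Y s ω * Z s ω)) := by
    intro X hX s hs t hst U hUm hU
    obtain ⟨q, hq, hqs, hlim⟩ := hZq' X hX s hs
    obtain ⟨N, hN⟩ := eventually_atTop.1 (hqs.eventually (gt_mem_nhds hst))
    have hqI : ∀ n, q n ∈ Set.Icc t₁ t₂ := fun n => ⟨hs.1.trans (hq n).1.le, (hq n).2.le⟩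
    refine CondLe.of_tendsto_right (mn := fun n => ℱ (q (n + N))) (fun n => ℱ.le _)
      (fun n => ℱ.mono (hq _).1.le) (fun n => hRm X hX _ (hqI (n + N))) hUm
      (fun n => hU _ (hqI _) (hN _ (Nat.le_add_left _ _)).le) ?_
    filter_upwards [hlim] with ω h using h.comp (tendsto_add_atTop_nat N)
  have h1I : t₁ ∈ Set.Ico t₁ t₂ := ⟨le_rfl, h12⟩
  have hZY : Z t₁ ≤ᵐ[μ] Y t₁ := by
    obtain ⟨q, hq, -, hlim⟩ := hZq t₁ h1I
    have hqI : ∀ n, q n ∈ Set.Icc t₁ t₂ := fun n => ⟨(hq n).1.le, (hq n).2.le⟩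
    have h := CondLe.ae_le (ℱ.le t₁) (hZm t₁ h1I).ennreal_ofReal (hWm t₁ (hco h1I))
      (CondLe.of_tendsto (fun n => ((hWm _ (hqI n)).mono (ℱ.le _) le_rfl).aemeasurable)
        (fun n => hWsup t₁ (hco h1I) _ (hqI n) (hq n).1.le) hlim)
    filter_upwards [h, hWc, hYpos t₁ (hco h1I)] with ω h1 h2 h3
    exact (ENNReal.ofReal_le_ofReal_iff h3.le).1 (h1.trans h2)
  set c : Ω → ℝ := fun ω => max 0 (1 - Z t₁ ω / Y t₁ ω) with hc
  have hc0 : ∀ ω, 0 ≤ c ω := fun ω => le_max_left _ _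
  have hcm : Measurable[ℱ t₁] c := measurable_const.max
    (measurable_const.sub ((hZm t₁ h1I).div (hYP.1 t₁ ht₁).measurable))
  have hc1 : ∀ᵐ ω ∂μ, Z t₁ ω / Y t₁ ω + c ω = 1 := by
    filter_upwards [hZY, hYpos t₁ (hco h1I)] with ω h1 h2
    have : Z t₁ ω / Y t₁ ω ≤ 1 := (div_le_one h2).2 h1
    rw [hc]
    simp only
    rw [max_eq_right (by linarith)]
    ring
  set V : ℝ → Ω → ℝ := spliceProc t₁ t₂ (fun t ω => Z t ω / Y t ω + c ω) g with hV
  have hVP : PosProc μ T ℱ V := by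
    refine posProc_spliceProc (fun t ht => ?_) hgm ?_ hg0 ?_ ?_
    · exact ((hZm t ht).div (hYP.1 t (hI (hco ht))).measurable).add
        (hcm.mono (ℱ.mono ht.1) le_rfl)
    · filter_upwards [hYP.2.1] with ω h t ht
      exact add_nonneg (div_nonneg (hZ0 t ω) (h t (hI (hco ht)))) (hc0 ω)
    · filter_upwards [hZpath, hYP.2.2, (hC Y hY).1.ae_exists_lower_bound hT hpos]
        with ω h1 h2 ⟨ε, hε, h3⟩ t ht
      exact ((h1.1 t ht).div (h2.1 t (hIT ht)) (hε.trans_le (h3 t (hI (hco ht)))).ne').add_const _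
    · filter_upwards [hZpath, hYP.2.2, (hC Y hY).1.ae_exists_lower_bound hT hpos]
        with ω h1 h2 ⟨ε, hε, h3⟩ t ht
      obtain ⟨L, hL⟩ := h1.2 t ht
      obtain ⟨M, hM⟩ := h2.2 t ⟨ht₁.1.trans_lt ht.1, ht.2.trans ht₂.2⟩
      have hMε : ε ≤ M := ge_of_tendsto hM <| by
        filter_upwards [Ioo_mem_nhdsLT ht.1] with x hx
        exact h3 x (hI ⟨hx.1.le, (hx.2.trans_le ht.2).le⟩)
      exact ⟨_, (hL.div hM (hε.trans_le hMε).ne').add_const _⟩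
  have hV1 : ∀ t ∈ Set.Icc 0 t₁, ∀ᵐ ω ∂μ, V t ω = 1 := by
    intro t ht
    rcases ht.2.eq_or_lt with rfl | hlt
    · filter_upwards [hc1] with ω h
      simpa [hV, spliceProc, h12] using h
    · exact Eventually.of_forall fun ω => by simp [hV, spliceProc, hlt, hlt.trans h12]
  have hV2 : ∀ t ∈ Set.Ico t₁ t₂, ∀ ω, V t ω = Z t ω / Y t ω + c ω := by
    intro t ht ω
    simp [hV, spliceProc, ht.2, ht.1.not_gt]
  have hV3 : ∀ t, t₂ ≤ t → V t = g := by
    intro t ht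
    ext ω
    simp [hV, spliceProc, ht.not_gt]
  refine ⟨hg.1, hg.2.1, V, ⟨hVP, fun X hX => ?_⟩, ?_⟩
  swap
  · filter_upwards [hV1 t₁ ⟨ht₁.1, le_rfl⟩] with ω h
    rw [h, hV3 t₂ le_rfl, div_one]
  have hXS := (hC X hX).1
  have hXV1 : ∀ t ∈ Set.Icc 0 t₁, (fun ω => ENNReal.ofReal (X t ω)) =ᵐ[μ]
      fun ω => ENNReal.ofReal (X t ω * V t ω) := by
    intro t ht
    filter_upwards [hV1 t ht] with ω h
    rw [h, mul_one]
  have hXV2 : ∀ t ∈ Set.Ico t₁ t₂, (fun ω => ENNReal.ofReal (X t ω / Y t ω * Z t ω) +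
      ENNReal.ofReal (c ω) * ENNReal.ofReal (X t ω)) =ᵐ[μ]
      fun ω => ENNReal.ofReal (X t ω * V t ω) := by
    intro t ht
    filter_upwards [hXS.1.2.1, hYpos t (hco ht)] with ω h1 h2
    have h1 := h1 t (hI (hco ht))
    rw [hV2 t ht, ← ENNReal.ofReal_mul (hc0 ω), ← ENNReal.ofReal_add
      (mul_nonneg (div_nonneg h1 h2.le) (hZ0 t ω)) (mul_nonneg (hc0 ω) h1)]
    congr 1
    ring
  have hXm : ∀ t ∈ Set.Icc 0 T, AEMeasurable (fun ω => ENNReal.ofReal (X t ω)) μ :=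
    fun t ht => (hXS.1.measurable ht).ennreal_ofReal.aemeasurable
  have h0 : (0 : ℝ) ∈ Set.Icc 0 t₁ := ⟨le_rfl, ht₁.1⟩
  have hmid : ∀ s ∈ Set.Icc 0 t₂, ∀ t ∈ Set.Icc 0 t₂, s ≤ t → t₁ ≤ s →
      CondLe μ (ℱ s) (fun ω => ENNReal.ofReal (X t ω * V t ω))
        (fun ω => ENNReal.ofReal (X s ω * V s ω)) := by
    intro s hs t ht hst h1s
    rcases hst.eq_or_lt with rfl | hst'
    · exact CondLe.of_ae_le (Filter.EventuallyLE.refl _ _)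
    have hsI : s ∈ Set.Ico t₁ t₂ := ⟨h1s, hst'.trans_le ht.2⟩
    rcases ht.2.eq_or_lt with rfl | ht2
    · have h := hright X hX s hsI t hst' _
        ((hgm.mono (ℱ.le t) le_rfl).mul (hXS.1.measurable ht₂)).ennreal_ofReal.aemeasurable
        (fun r hr _ => hWb X hX r hr)
      refine (CondLe.of_ae_le (Eventually.of_forall fun ω => ?_)).trans
        (h.trans ((CondLe.of_ae_le (Eventually.of_forall fun ω => ?_)).trans
          (CondLe.of_ae_le (hXV2 s hsI).le)))
      · simp [hV3 t le_rfl, mul_comm]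
      · exact le_self_add
    · have htI : t ∈ Set.Ico t₁ t₂ := ⟨h1s.trans hst, ht2⟩
      have h := hright X hX s hsI t hst' _ (hVm X hX t htI).aemeasurable
        (fun r hr hrt => hleft X hX r hr t htI hrt)
      have h' := (hXS.condLe (hI (hco hsI)) (hI (hco htI)) hst).mul_left (ℱ.le s)
        (hXm t (hI (hco htI))) (hXm s (hI (hco hsI)))
        (hcm.mono (ℱ.mono h1s) le_rfl).ennreal_ofReal
      exact (h.add (hVm X hX t htI).aemeasurable (hVm X hX s hsI).aemeasurable h').congr
        (hXV2 t htI) (hXV2 s hsI)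
  have hlow : ∀ s ∈ Set.Icc 0 t₂, ∀ t ∈ Set.Icc 0 t₂, s ≤ t →
      CondLe μ (ℱ s) (fun ω => ENNReal.ofReal (X t ω * V t ω))
        (fun ω => ENNReal.ofReal (X s ω * V s ω)) := by
    refine condLe_glue (v := fun t ω => ENNReal.ofReal (X t ω * V t ω)) (c := t₁)
      ⟨ht₁.1, h12.le⟩ (fun s hs t ht hst ht1 => ?_) hmid
    exact (hXS.condLe ⟨hs.1, hs.2.trans ht₂.2⟩ ⟨ht.1, ht.2.trans ht₂.2⟩ hst).congr
      (hXV1 t ⟨ht.1, ht1⟩) (hXV1 s ⟨hs.1, hst.trans ht1⟩)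
  have hall : ∀ s ∈ Set.Icc 0 T, ∀ t ∈ Set.Icc 0 T, s ≤ t →
      CondLe μ (ℱ s) (fun ω => ENNReal.ofReal (X t ω * V t ω))
        (fun ω => ENNReal.ofReal (X s ω * V s ω)) := by
    refine condLe_glue (v := fun t ω => ENNReal.ofReal (X t ω * V t ω)) (c := t₂) ht₂
      (fun s hs t ht hst ht2 => hlow s ⟨hs.1, hst.trans ht2⟩ t ⟨ht.1, ht2⟩ hst)
      (fun s hs t ht hst h2s => ?_)
    have hX' : ∀ r ∈ Set.Icc 0 T, t₂ ≤ r →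
        (fun ω => ENNReal.ofReal (g ω) * ENNReal.ofReal (X r ω)) =ᵐ[μ]
        fun ω => ENNReal.ofReal (X r ω * V r ω) := by
      intro r hr h2r
      filter_upwards [hg0] with ω h
      rw [hV3 r h2r, ← ENNReal.ofReal_mul h, mul_comm]
    exact ((hXS.condLe hs ht hst).mul_left (ℱ.le s) (hXm t ht) (hXm s hs)
      (hgm.mono (ℱ.mono h2s) le_rfl).ennreal_ofReal).congr (hX' t ht (h2s.trans hst)) (hX' s hs h2s)
  refine ⟨(hXS.1.mul hVP).superMG_of_condLe ?_ fun s t hs ht hst => hall s hs t ht hst, ?_⟩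
  · rw [← lintegral_congr_ae (hXV1 0 h0)]
    exact ne_top_of_le_ne_top ENNReal.one_ne_top
      ((hC X hX).lintegral_le ⟨le_rfl, hT.le⟩)
  · filter_upwards [hV1 0 h0, (hC X hX).2] with ω h1 h2
    rwa [h1, mul_one]

end DualProcess

section SolidConvex

variable {m0 : MeasurableSpace Ω} {μ : Measure Ω} {T : ℝ}
  {ℱ : Filtration ℝ m0} {C : Set (ℝ → Ω → ℝ)} {t₁ t₂ : ℝ}

theorem mem_incrSet_of_le (hsolid : ProcSolid μ T ℱ C) (h12 : t₁ < t₂) (ht₁ : t₁ ∈ Set.Icc 0 T)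
    {f g : Ω → ℝ} (hf : f ∈ incrSet μ ℱ t₁ t₂ C) (hg : StronglyMeasurable[ℱ t₂] g)
    (hg0 : ∀ᵐ ω ∂μ, 0 ≤ g ω) (hgf : g ≤ᵐ[μ] f) : g ∈ incrSet μ ℱ t₁ t₂ C := by
  obtain ⟨hfm, hf0, X, hX, hfX⟩ := hf
  set b : Ω → ℝ := fun ω => min 1 (g ω / f ω) with hb
  have hb0 : 0 ≤ᵐ[μ] b := by
    filter_upwards [hg0, hf0] with ω h h' using le_min zero_le_one (div_nonneg h h')
  have hbm : Measurable[ℱ t₂] b := measurable_const.min (hg.measurable.div hfm.measurable)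
  have hB : Vmem μ T ℱ (spliceProc t₁ t₂ (fun _ _ => 1) b) := by
    refine ⟨posProc_spliceProc (fun _ _ => measurable_const) hbm
      (Eventually.of_forall fun _ _ _ => zero_le_one) hb0
      (Eventually.of_forall fun _ _ _ => tendsto_const_nhds)
      (Eventually.of_forall fun _ _ _ => ⟨1, tendsto_const_nhds⟩), ?_, ?_⟩
    · refine Eventually.of_forall fun ω s _ t _ hst => ?_
      by_cases ht : t < t₂
      · simp [spliceProc, ht, hst.trans_lt ht]
      · by_cases hs : s < t₂
        · simp [spliceProc, ht, hs, hb]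
        · simp [spliceProc, ht, hs]
    · refine Eventually.of_forall fun ω => ?_
      simp [spliceProc, ht₁.1.trans_lt h12]
  refine ⟨hg, hg0, _, hsolid X hX _ hB, ?_⟩
  filter_upwards [hg0, hgf, hf0, hfX] with ω h0 h1 h2 h3
  have e1 : spliceProc t₁ t₂ (fun _ _ => 1) b t₁ ω = 1 := by simp [spliceProc, h12]
  have e2 : spliceProc t₁ t₂ (fun _ _ => 1) b t₂ ω = b ω := by simp [spliceProc]
  rw [e1, e2, mul_one, mul_div_right_comm, ← h3, hb]
  rcases h2.eq_or_lt with h2 | h2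
  · rw [← h2, zero_mul]
    exact le_antisymm (h2 ▸ h1) h0
  · simp only
    rw [min_eq_right (div_le_one_of_le₀ h1 h2.le), mul_div_cancel₀ _ h2.ne']

theorem convexComb_mem_incrSet [IsProbabilityMeasure μ] (hC : ∀ X ∈ C, S1mem μ T ℱ X)
    (hfork : ForkConvex μ T ℱ C) (hsolid : ProcSolid μ T ℱ C) (hfar : FarReaching μ T C)
    (ht₁ : t₁ ∈ Set.Icc 0 T) (ht₂ : t₂ ∈ Set.Icc 0 T) (h12 : t₁ < t₂) {f g : Ω → ℝ}
    (hf : f ∈ incrSet μ ℱ t₁ t₂ C) (hg : g ∈ incrSet μ ℱ t₁ t₂ C) {c : ℝ} (hc0 : 0 ≤ c)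
    (hc1 : c ≤ 1) : (fun ω => c * f ω + (1 - c) * g ω) ∈ incrSet μ ℱ t₁ t₂ C := by
  obtain ⟨hfm, hf0, X, hX, hfX⟩ := hf
  obtain ⟨hgm, hg0, X', hX', hgX⟩ := hg
  obtain ⟨Y, hY, hpos⟩ := hfar
  have hF := hfork t₁ ht₁ (fun _ => c) stronglyMeasurable_const (fun _ => hc0) (fun _ => hc1)
    Y hY X hX X' hX'
  have hc1' : 0 ≤ 1 - c := sub_nonneg.2 hc1
  refine mem_incrSet_of_le hsolid h12 ht₁ (incr_mem_incrSet (hC _ hF).1.1 hF ht₁ ht₂ h12.le)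
    ((hfm.const_mul c).add (hgm.const_mul (1 - c))) ?_ ?_
  · filter_upwards [hf0, hg0] with ω h h' using
      add_nonneg (mul_nonneg hc0 h) (mul_nonneg hc1' h')
  · filter_upwards [hfX, hgX, (hC Y hY).1.ae_pos hpos ht₁, (hC X hX).1.1.2.1,
      (hC X' hX').1.1.2.1] with ω h1 h2 hy hx hx'
    simp only [lt_irrefl, if_false, h12.not_gt]
    rw [mul_div_mul_left _ _ hy.ne', h1, h2]
    have hx1 := hx t₁ ht₁
    have hx1' := hx' t₁ ht₁
    have hx2 := div_nonneg (hx t₂ ht₂) hx1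
    have hx2' := div_nonneg (hx' t₂ ht₂) hx1'
    have hN := add_nonneg (mul_nonneg hc0 hx2) (mul_nonneg hc1' hx2')
    have hD : c * (X t₁ ω / X t₁ ω) + (1 - c) * (X' t₁ ω / X' t₁ ω) ≤ 1 := by
      have a1 := mul_le_mul_of_nonneg_left (div_self_le_one (X t₁ ω)) hc0
      have a2 := mul_le_mul_of_nonneg_left (div_self_le_one (X' t₁ ω)) hc1'
      linarith
    have hD0 : 0 ≤ c * (X t₁ ω / X t₁ ω) + (1 - c) * (X' t₁ ω / X' t₁ ω) :=
      add_nonneg (mul_nonneg hc0 (div_nonneg hx1 hx1)) (mul_nonneg hc1' (div_nonneg hx1' hx1'))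
    rcases hD0.eq_or_lt with h0 | h0
    · have z : ∀ a x y : ℝ, a * (x / x) = 0 → a * (y / x) = 0 := by
        intro a x y h
        rcases mul_eq_zero.1 h with h | h
        · rw [h, zero_mul]
        · rw [(div_eq_zero_iff.1 h).elim id id, div_zero, mul_zero]
      have z1 := (add_eq_zero_iff_of_nonneg (mul_nonneg hc0 (div_nonneg hx1 hx1))
        (mul_nonneg hc1' (div_nonneg hx1' hx1'))).1 h0.symm
      rw [z _ _ _ z1.1, z _ _ _ z1.2]
      simp
    · exact le_div_self hN h0 hD

end SolidConvex

/-- For `C ⊆ S₁` fork-convex, solid and far-reaching and `t₁ < t₂` in `[0,T]`, the set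
of increments `C_{t₂,t₁}` is solid and convex, and its conditional polar with respect
to `F_{t₁}` equals `(C^×)_{t₂,t₁}`. -/
theorem incr_solid_convex_polar {m0 : MeasurableSpace Ω} (μ : Measure Ω)
    [IsProbabilityMeasure μ] (T : ℝ) (hT : 0 < T) (ℱ : Filtration ℝ m0)
    (hrc : ∀ t : ℝ, (ℱ t : MeasurableSpace Ω) = ⨅ (s : ℝ) (_ : t < s), ℱ s)
    (hcomp : ∀ A : Set Ω, μ A = 0 → MeasurableSet[ℱ 0] A)
    (htriv : ∀ A : Set Ω, MeasurableSet[ℱ 0] A → μ A = 0 ∨ μ A = 1)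
    (C : Set (ℝ → Ω → ℝ)) (hC : ∀ X ∈ C, S1mem μ T ℱ X)
    (hfork : ForkConvex μ T ℱ C) (hsolid : ProcSolid μ T ℱ C)
    (hfar : FarReaching μ T C)
    (t₁ t₂ : ℝ) (ht₁ : t₁ ∈ Set.Icc (0 : ℝ) T) (ht₂ : t₂ ∈ Set.Icc (0 : ℝ) T)
    (h12 : t₁ < t₂) :
    (∀ f ∈ incrSet μ ℱ t₁ t₂ C, ∀ g : Ω → ℝ, StronglyMeasurable[ℱ t₂] g →
      (∀ᵐ ω ∂μ, 0 ≤ g ω) → g ≤ᵐ[μ] f → g ∈ incrSet μ ℱ t₁ t₂ C) ∧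
    (∀ f ∈ incrSet μ ℱ t₁ t₂ C, ∀ g ∈ incrSet μ ℱ t₁ t₂ C, ∀ c : ℝ, 0 ≤ c → c ≤ 1 →
      (fun ω => c * f ω + (1 - c) * g ω) ∈ incrSet μ ℱ t₁ t₂ C) ∧
    condPolarAt μ ℱ t₁ t₂ (incrSet μ ℱ t₁ t₂ C) =
      incrSet μ ℱ t₁ t₂ (procPolar μ T ℱ C) := by
  exact ⟨fun _ hf _ hg hg0 hgf => mem_incrSet_of_le hsolid h12 ht₁ hf hg hg0 hgf,
    fun _ hf _ hg _ hc0 hc1 => convexComb_mem_incrSet hC hfork hsolid hfar ht₁ ht₂ h12 hf hg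
      hc0 hc1,
    (condPolarAt_subset_incrSet_procPolar hT hrc hC hfork hfar ht₁ ht₂ h12).antisymm
      (incrSet_procPolar_subset_condPolarAt hC ht₁ ht₂ h12.le)⟩
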